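/- arXiv:2206.01827 — 2 statements merged into one kernel-verified Lean document; each statement's English description precedes it below -/
import Mathlib

section
/- Let χ > 0 and suppose ∫ z^{2+χ} dJ(z) < ∞ and J is absolutely continuous with a density bounded away from 0 on every compact subset of [0,∞). Then there exists exactly one CDF φ with ∫ x dφ(x) = 0 such that f_x(t) := φ(x − v t) is a mean-field model (a traveling wave shape with mean 0); moreover this φ satisfies ∫ |y|^{1+χ} dφ(y) < ∞. -/
open MeasureTheory Filter Set ENNReal NNReal

noncomputable section

/-- sign: `1` if `0 ≤ y`, `-1` otherwise. -/
def sgn (y : ℝ) : ℝ := if 0 ≤ y then 1 else -1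

/-- `F` is a (proper) cumulative distribution function. -/
structure IsCDF (F : ℝ → ℝ) : Prop where
  mono : Monotone F
  right_continuous : ∀ x, ContinuousWithinAt F (Set.Ici x) x
  tendsto_atBot : Filter.Tendsto F Filter.atBot (nhds 0)
  tendsto_atTop : Filter.Tendsto F Filter.atTop (nhds 1)

open Classical in
/-- The Lebesgue–Stieltjes measure associated with `F` (junk value `0` if `F` is not
monotone right-continuous). -/
noncomputable def cdfMeasure (F : ℝ → ℝ) : Measure ℝ :=
  if h : Monotone F ∧ ∀ x, ContinuousWithinAt F (Set.Ici x) x then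
    StieltjesFunction.measure ⟨F, h.1, h.2⟩
  else 0

/-- Quantile (generalized inverse) of `F`. -/
noncomputable def quantile (F : ℝ → ℝ) (ν : ℝ) : ℝ := sInf {y | ν ≤ F y}

/-- Complementary CDF of the jump-size distribution `J`. -/
noncomputable def Jbar (J : Measure ℝ) (u : ℝ) : ℝ := (J (Set.Ioi u)).toReal

/-- Right-hand side of the mean-field-model equation (with the minus sign). -/
noncomputable def mfmRHS (η : ℝ → ℝ) (J : Measure ℝ) (F : ℝ → ℝ) (x : ℝ) : ℝ :=
  -∫ ν in Set.Ioo (0:ℝ) 1,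
      η ν * (if quantile F ν ≤ x then Jbar J (x - quantile F ν) else 0)

/-- Mean-field model: (a) each `f ⬝ t` is a CDF; (b) `t ↦ f x t` is nonincreasing and
Lipschitz with constant independent of `x`; (c) wherever the `t`-derivative exists it
equals the mean-field right-hand side. -/
def IsMFM (η : ℝ → ℝ) (J : Measure ℝ) (f : ℝ → ℝ → ℝ) : Prop :=
  (∀ t : ℝ, 0 ≤ t → IsCDF (fun x => f x t)) ∧
  (∀ x : ℝ, AntitoneOn (f x) (Set.Ici 0)) ∧
  (∃ c : NNReal, ∀ x : ℝ, LipschitzOnWith c (f x) (Set.Ici 0)) ∧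
  (∀ x t : ℝ, 0 ≤ t → ∀ d : ℝ,
    HasDerivWithinAt (f x) d (Set.Ici 0) t → d = mfmRHS η J (fun y => f y t) x)

/-- The nondecreasing rearrangement of a finite tuple. -/
noncomputable def sortVec {n : ℕ} (w : Fin n → ℝ) : Fin n → ℝ := fun i => w (Tuple.sort w i)

/-- Outcome of one jump urge: `p = (ℓ, u, z)`; if `u ≤ η_n ℓ` the rank-`ℓ` particle jumps by
`z`, everything is recentered by `z/n` and sorted; otherwise nothing happens. -/
noncomputable def jumpOutcome (n : ℕ) (ηn : Fin n → ℝ) (w : Fin n → ℝ)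
    (p : Fin n × ℝ × ℝ) : Fin n → ℝ :=
  if p.2.1 ≤ ηn p.1 then
    sortVec (fun i => w i + (if i = p.1 then p.2.2 else 0) - p.2.2 / n)
  else w

/-- The Markov transition kernel of the embedded (centered) jump chain: `ℓ` uniform on
`Fin n`, `u` uniform on `[0,1]`, `z ∼ J`, independent. -/
noncomputable def Kn (n : ℕ) (ηn : Fin n → ℝ) (J : Measure ℝ) (w : Fin n → ℝ) :
    Measure (Fin n → ℝ) :=
  Measure.map (jumpOutcome n ηn w)
    ((((n : ℝ≥0∞))⁻¹ • (Measure.count : Measure (Fin n))).prod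
      ((MeasureTheory.volume.restrict (Set.Icc (0:ℝ) 1)).prod J))

/-- The state space: nondecreasing, centered configurations. -/
def Wset (n : ℕ) : Set (Fin n → ℝ) := {w | Monotone w ∧ ∑ i, w i = 0}

/-- `p`-th absolute empirical moment. -/
noncomputable def Phi (n : ℕ) (p : ℝ) (w : Fin n → ℝ) : ℝ :=
  (1 / n) * ∑ i, |w i| ^ p

/-- The drift functional `G_n`. -/
noncomputable def Gn (n : ℕ) (χ : ℝ) (ηn : Fin n → ℝ) (w : Fin n → ℝ) : ℝ :=
  (2 + χ) * ((1 / n) * ∑ i, (ηn i - (1 / n) * ∑ ℓ, ηn ℓ) * sgn (w i) * |w i| ^ (1 + χ))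

/-- Empirical CDF of the configuration `w`. -/
noncomputable def empCDF (n : ℕ) (w : Fin n → ℝ) (x : ℝ) : ℝ :=
  (1 / n) * (Finset.univ.filter (fun i => w i ≤ x)).card

/-- `J` is absolutely continuous with a density bounded away from `0` on every compact
subset of `[0, ∞)`. -/
def DensityLowerBdd (J : Measure ℝ) : Prop :=
  ∃ g : ℝ → ℝ≥0∞, J = MeasureTheory.volume.withDensity g ∧
    ∀ b : ℝ, 0 < b → ∃ c : ℝ≥0∞, 0 < c ∧ ∀ x ∈ Set.Icc (0:ℝ) b, c ≤ g x

/-- The test-function class `C_b`: bounded continuous functions that are constant near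
`-∞` and near `+∞`. -/
def CbTail (h : ℝ → ℝ) : Prop :=
  Continuous h ∧ (∃ M : ℝ, ∀ x, |h x| ≤ M) ∧
    ∃ a b : ℝ, a ≤ b ∧ (∀ x ≤ a, h x = h a) ∧ (∀ x, b ≤ x → h x = h b)

/-- The generator-type operator `L[F]h`. -/
noncomputable def Lop (η : ℝ → ℝ) (J : Measure ℝ) (F : ℝ → ℝ) (h : ℝ → ℝ) : ℝ :=
  ∫ ν in Set.Ioo (0:ℝ) 1, η ν * ∫ z, (h (quantile F ν + z) - h (quantile F ν)) ∂J

end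

open scoped Topology

/-- The stationary excess law of `J`: the image under `(u, z) ↦ z` of `J(du) dz` restricted to
`0 < z < u`, i.e. the measure with density `z ↦ J (Ioi z)` on `(0, ∞)`. -/
noncomputable def excessLaw (J : Measure ℝ) : Measure ℝ :=
  ((J.prod volume).restrict {p : ℝ × ℝ | 0 < p.2 ∧ p.2 < p.1}).map Prod.snd

lemma measurableSet_between : MeasurableSet {p : ℝ × ℝ | 0 < p.2 ∧ p.2 < p.1} :=
  (measurableSet_lt measurable_const measurable_snd).inter
    (measurableSet_lt measurable_snd measurable_fst)

lemma lintegral_excessLaw {J : Measure ℝ} [SFinite J] {f : ℝ → ℝ≥0∞} (hf : Measurable f) :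
    ∫⁻ z, f z ∂(excessLaw J) = ∫⁻ u, (∫⁻ z in Ioo 0 u, f z) ∂J := by
  rw [excessLaw, lintegral_map hf measurable_snd,
    ← lintegral_indicator measurableSet_between,
    lintegral_prod (μ := J) (ν := volume) (fun p => indicator _ (fun p : ℝ × ℝ => f p.2) p)
      ((hf.comp measurable_snd).indicator measurableSet_between).aemeasurable]
  refine lintegral_congr fun u => ?_
  rw [← lintegral_indicator measurableSet_Ioo]
  rfl

lemma excessLaw_univ {J : Measure ℝ} [SFinite J] (hJmean : ∫ z, z ∂J = 1) (hJ0 : J (Iic 0) = 0) :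
    excessLaw J univ = 1 := by
  have hint : Integrable (fun z : ℝ => z) J := by
    by_contra h
    rw [integral_undef h] at hJmean
    exact zero_ne_one hJmean
  have hpos : 0 ≤ᵐ[J] fun z : ℝ => z := by
    have : ∀ᵐ z ∂J, z ∉ Iic (0 : ℝ) := measure_eq_zero_iff_ae_notMem.1 hJ0
    filter_upwards [this] with z hz
    exact (not_le.1 hz).le
  have h := lintegral_excessLaw (J := J) (f := fun _ => 1) measurable_const
  simp only [lintegral_const, one_mul, Measure.restrict_apply_univ, Real.volume_Ioo, sub_zero] at h
  rw [h, ← ofReal_integral_eq_lintegral_ofReal hint hpos, hJmean, ENNReal.ofReal_one]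

lemma excessLaw_Iic_zero {J : Measure ℝ} : excessLaw J (Iic 0) = 0 := by
  rw [excessLaw, Measure.map_apply measurable_snd measurableSet_Iic,
    Measure.restrict_apply (measurable_snd measurableSet_Iic)]
  convert measure_empty (μ := J.prod volume)
  ext p
  simp only [mem_inter_iff, mem_preimage, mem_Iic, mem_ofPred_eq, mem_empty_iff_false, iff_false]
  rintro ⟨h1, h2, -⟩
  linarith

lemma integral_excessLaw {J : Measure ℝ} [IsFiniteMeasure J] [hfin : IsFiniteMeasure (excessLaw J)]
    {G : ℝ → ℝ} (hG : Measurable G) {C : ℝ} (hC : ∀ x, |G x| ≤ C) :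
    ∫ z, G z ∂(excessLaw J) = ∫ u, (∫ z in Ioo 0 u, G z) ∂J := by
  have hint : Integrable G (excessLaw J) :=
    Integrable.of_bound hG.aestronglyMeasurable C (Eventually.of_forall hC)
  have hint' : IntegrableOn (fun p : ℝ × ℝ => G p.2) {p : ℝ × ℝ | 0 < p.2 ∧ p.2 < p.1}
      (J.prod volume) := by
    rw [excessLaw] at hint
    exact hint.comp_measurable measurable_snd
  rw [excessLaw, integral_map measurable_snd.aemeasurable hG.aestronglyMeasurable,
    ← integral_indicator measurableSet_between,
    integral_prod _ (hint'.integrable_indicator measurableSet_between)]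
  refine integral_congr_ae (Eventually.of_forall fun u => ?_)
  beta_reduce
  rw [← integral_indicator measurableSet_Ioo]
  rfl

/-- Averaging over the excess law as a double integral against `J`. -/
lemma integral_excessLaw_comp_sub {J : Measure ℝ} [IsFiniteMeasure J]
    [IsFiniteMeasure (excessLaw J)] (hJ0 : J (Iic 0) = 0)
    {G : ℝ → ℝ} (hG : Measurable G) {C : ℝ} (hC : ∀ x, |G x| ≤ C) (x : ℝ) :
    ∫ z, G (x - z) ∂(excessLaw J) = ∫ u, (∫ y in (x - u)..x, G y) ∂J := by
  rw [integral_excessLaw (G := fun z => G (x - z))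
    (hG.comp (measurable_const.sub measurable_id)) (fun z => hC (x - z))]
  have : ∀ᵐ z ∂J, z ∉ Iic (0 : ℝ) := measure_eq_zero_iff_ae_notMem.1 hJ0
  refine integral_congr_ae ?_
  filter_upwards [this] with u hu
  have hu : 0 ≤ u := (not_le.1 hu).le
  rw [← integral_Ioc_eq_integral_Ioo, ← intervalIntegral.integral_of_le hu,
    intervalIntegral.integral_comp_sub_left (fun y => G y) x]
  simp

lemma intervalIntegrable_of_abs_le {G : ℝ → ℝ} (hG : Measurable G) {C : ℝ} (hC : ∀ x, |G x| ≤ C)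
    (a b : ℝ) : IntervalIntegrable G volume a b :=
  (intervalIntegrable_const (c := C)).mono_fun hG.aestronglyMeasurable
    (Eventually.of_forall fun x => (hC x).trans (le_abs_self C))

lemma abs_intervalIntegral_le {G : ℝ → ℝ} {C : ℝ} (hC : ∀ x, |G x| ≤ C)
    (a b : ℝ) : |∫ y in a..b, G y| ≤ C * |b - a| :=
  intervalIntegral.norm_integral_le_of_norm_le_const (f := G) fun x _ => hC x

lemma measurable_intervalIntegral_sub {G : ℝ → ℝ} (hG : Measurable G) {C : ℝ}
    (hC : ∀ x, |G x| ≤ C) (x : ℝ) : Measurable fun u : ℝ => ∫ y in (x - u)..x, G y := by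
  have h : Continuous fun t : ℝ => ∫ y in x..t, G y :=
    intervalIntegral.continuous_primitive (intervalIntegrable_of_abs_le hG hC) x
  have h2 : (fun u : ℝ => ∫ y in (x - u)..x, G y) = fun u => -∫ y in x..(x - u), G y := by
    funext u
    exact intervalIntegral.integral_symm _ _
  rw [h2]
  exact ((h.comp (continuous_const.sub continuous_id)).neg).measurable

lemma integrable_intervalIntegral_sub {J : Measure ℝ} (hJ : Integrable (fun z : ℝ => z) J)
    {G : ℝ → ℝ} (hG : Measurable G) {C : ℝ}
    (hC : ∀ x, |G x| ≤ C) (x : ℝ) : Integrable (fun u : ℝ => ∫ y in (x - u)..x, G y) J := by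
  refine (hJ.abs.const_mul C).mono'
    (measurable_intervalIntegral_sub hG hC x).aestronglyMeasurable
    (Eventually.of_forall fun u => ?_)
  have := abs_intervalIntegral_le hC (x - u) x
  rwa [show x - (x - u) = u by ring] at this

/-- Averaging a `[0,1]`-valued function over the excess law gives a `1`-Lipschitz function. -/
lemma abs_integral_excessLaw_sub_le {J : Measure ℝ} [IsProbabilityMeasure J]
    [IsFiniteMeasure (excessLaw J)] (hJ : Integrable (fun z : ℝ => z) J)
    (hJ0 : J (Iic 0) = 0) {G : ℝ → ℝ} (hG : Measurable G) (h0 : ∀ x, 0 ≤ G x)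
    (h1 : ∀ x, G x ≤ 1) (x y : ℝ) :
    |∫ z, G (x - z) ∂(excessLaw J) - ∫ z, G (y - z) ∂(excessLaw J)| ≤ |x - y| := by
  have hC : ∀ x, |G x| ≤ 1 := fun x => by rw [abs_of_nonneg (h0 x)]; exact h1 x
  have hI := intervalIntegrable_of_abs_le hG hC
  wlog hxy : y ≤ x generalizing x y
  · rw [abs_sub_comm, abs_sub_comm x]
    exact this y x (le_of_not_ge hxy)
  rw [integral_excessLaw_comp_sub hJ0 hG hC, integral_excessLaw_comp_sub hJ0 hG hC,
    ← integral_sub (integrable_intervalIntegral_sub hJ hG hC x)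
      (integrable_intervalIntegral_sub hJ hG hC y)]
  have key : ∀ u : ℝ, |(∫ t in (x - u)..x, G t) - ∫ t in (y - u)..y, G t| ≤ |x - y| := by
    intro u
    have e1 : (∫ t in (x - u)..x, G t) - ∫ t in (y - u)..y, G t
        = (∫ t in y..x, G t) - ∫ t in (y - u)..(x - u), G t := by
      have a1 := intervalIntegral.integral_add_adjacent_intervals (hI (y - u) (x - u))
        (hI (x - u) x)
      have a2 := intervalIntegral.integral_add_adjacent_intervals (hI (y - u) y) (hI y x)
      linarith
    have b : ∀ a b : ℝ, a ≤ b → 0 ≤ ∫ t in a..b, G t ∧ ∫ t in a..b, G t ≤ b - a := by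
      intro a b hab
      refine ⟨intervalIntegral.integral_nonneg hab fun t _ => h0 t, ?_⟩
      have := abs_intervalIntegral_le hC a b
      rw [one_mul, abs_of_nonneg (sub_nonneg.2 hab)] at this
      exact (le_abs_self _).trans this
    have b1 := b y x hxy
    have b2 := b (y - u) (x - u) (by linarith)
    rw [e1, abs_of_nonneg (sub_nonneg.2 hxy), abs_le]
    constructor <;> linarith
  have := norm_integral_le_of_norm_le_const (μ := J)
    (f := fun u => (∫ t in (x - u)..x, G t) - ∫ t in (y - u)..y, G t) (Eventually.of_forall key)
  simpa using this

/-- Derivative of the average of a bounded continuous function over the excess law. -/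
lemma hasDerivAt_integral_excessLaw {J : Measure ℝ} [IsProbabilityMeasure J]
    [IsFiniteMeasure (excessLaw J)] (hJ : Integrable (fun z : ℝ => z) J)
    (hJ0 : J (Iic 0) = 0) {G : ℝ → ℝ} (hG : Continuous G) {C : ℝ} (hC : ∀ x, |G x| ≤ C) (x : ℝ) :
    HasDerivAt (fun x => ∫ z, G (x - z) ∂(excessLaw J)) (∫ u, (G x - G (x - u)) ∂J) x := by
  have hI := intervalIntegrable_of_abs_le hG.measurable hC
  simp_rw [fun x => integral_excessLaw_comp_sub (J := J) hJ0 hG.measurable hC x]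
  refine (hasDerivAt_integral_of_dominated_loc_of_deriv_le (s := univ) (bound := fun _ => C + C)
    (F' := fun x u => G x - G (x - u)) univ_mem
    (Eventually.of_forall fun x =>
      (measurable_intervalIntegral_sub hG.measurable hC x).aestronglyMeasurable)
    (integrable_intervalIntegral_sub hJ hG.measurable hC x)
    (by fun_prop) (Eventually.of_forall fun u y _ => ?_)
    (integrable_const _) (Eventually.of_forall fun u y _ => ?_)).2
  · exact (abs_sub _ _).trans (add_le_add (hC _) (hC _))
  · have h : ∀ t, HasDerivAt (fun t => ∫ y in (0:ℝ)..t, G y) (G t) t := fun t =>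
      intervalIntegral.integral_hasDerivAt_right (hI 0 t)
        (hG.stronglyMeasurableAtFilter _ _) hG.continuousAt
    have h2 := (h y).sub ((h (y - u)).comp y ((hasDerivAt_id y).sub_const u))
    rw [mul_one] at h2
    convert h2 using 1
    funext t
    exact (intervalIntegral.integral_interval_sub_left (hI _ _) (hI _ _)).symm

lemma IsCDF.nonneg {F : ℝ → ℝ} (hF : IsCDF F) (x : ℝ) : 0 ≤ F x :=
  hF.mono.le_of_tendsto hF.tendsto_atBot x

lemma IsCDF.le_one {F : ℝ → ℝ} (hF : IsCDF F) (x : ℝ) : F x ≤ 1 :=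
  hF.mono.ge_of_tendsto hF.tendsto_atTop x

lemma IsCDF.quantile_le_iff {F : ℝ → ℝ} (hF : IsCDF F) {ν : ℝ} (hν : ν ∈ Ioo (0 : ℝ) 1) (x : ℝ) :
    quantile F ν ≤ x ↔ ν ≤ F x := by
  have hne : {y | ν ≤ F y}.Nonempty :=
    ((hF.tendsto_atTop.eventually (lt_mem_nhds hν.2)).exists).imp fun _ h => le_of_lt h
  have hbdd : BddBelow {y | ν ≤ F y} := by
    obtain ⟨b, hb⟩ := (hF.tendsto_atBot.eventually (gt_mem_nhds hν.1)).exists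
    exact ⟨b, fun y hy => le_of_not_ge fun h => absurd (hF.mono h) (not_le.2 (hb.trans_le hy))⟩
  constructor
  · intro h
    refine le_trans ?_ (hF.mono h)
    have hc := (hF.right_continuous (quantile F ν)).mono_left
      (nhdsWithin_mono _ Ioi_subset_Ici_self)
    refine ge_of_tendsto hc ?_
    filter_upwards [self_mem_nhdsWithin] with y hy
    obtain ⟨z, hz, hzy⟩ := exists_lt_of_csInf_lt hne hy
    exact le_trans hz (hF.mono hzy.le)
  · intro h
    exact csInf_le hbdd h

/-- Continuous extension of the jump-rate function from `[0, 1]` to `ℝ`. -/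
noncomputable def rateExt (η : ℝ → ℝ) : ℝ → ℝ :=
  IccExtend (zero_le_one' ℝ) (domRestrict (Icc 0 1) η)

/-- The primitive `u ↦ ∫₀ᵘ η` of the (extended) jump-rate function. -/
noncomputable def cumRate (η : ℝ → ℝ) (u : ℝ) : ℝ := ∫ ν in (0 : ℝ)..u, rateExt η ν

section cumRate

variable {η : ℝ → ℝ}

lemma rateExt_of_mem {x : ℝ} (hx : x ∈ Icc (0 : ℝ) 1) : rateExt η x = η x :=
  IccExtend_of_mem _ _ hx

lemma continuous_rateExt (hη : ContinuousOn η (Icc 0 1)) : Continuous (rateExt η) :=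
  (continuousOn_iff_continuous_domRestrict.1 hη).Icc_extend'

lemma rateExt_mem (hη_anti : StrictAntiOn η (Icc 0 1)) (hη0 : η 0 = 1) (hη1 : η 1 = 0) (x : ℝ) :
    rateExt η x ∈ Icc (0 : ℝ) 1 := by
  have hx := (projIcc (0 : ℝ) 1 zero_le_one x).2
  have h1 := hη_anti.antitoneOn hx (right_mem_Icc.2 zero_le_one) hx.2
  have h0 := hη_anti.antitoneOn (left_mem_Icc.2 zero_le_one) hx hx.1
  rw [hη1] at h1
  rw [hη0] at h0
  exact ⟨h1, h0⟩

lemma hasDerivAt_cumRate (hη : ContinuousOn η (Icc 0 1)) (x : ℝ) :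
    HasDerivAt (cumRate η) (rateExt η x) x :=
  intervalIntegral.integral_hasDerivAt_right ((continuous_rateExt hη).intervalIntegrable _ _)
    ((continuous_rateExt hη).stronglyMeasurableAtFilter _ _) (continuous_rateExt hη).continuousAt

lemma continuous_cumRate (hη : ContinuousOn η (Icc 0 1)) : Continuous (cumRate η) :=
  continuous_iff_continuousAt.2 fun x => (hasDerivAt_cumRate hη x).continuousAt

lemma cumRate_zero : cumRate η 0 = 0 := intervalIntegral.integral_same

lemma cumRate_one : cumRate η 1 = ∫ ν in Ioo (0 : ℝ) 1, η ν := by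
  rw [cumRate, intervalIntegral.integral_of_le zero_le_one, integral_Ioc_eq_integral_Ioo]
  exact setIntegral_congr_fun measurableSet_Ioo fun x hx => rateExt_of_mem (Ioo_subset_Icc_self hx)

lemma cumRate_sub (hη : ContinuousOn η (Icc 0 1)) (a b : ℝ) :
    cumRate η b - cumRate η a = ∫ ν in a..b, rateExt η ν :=
  intervalIntegral.integral_interval_sub_left ((continuous_rateExt hη).intervalIntegrable _ _)
    ((continuous_rateExt hη).intervalIntegrable _ _)

lemma monotone_cumRate (hη : ContinuousOn η (Icc 0 1)) (hη_anti : StrictAntiOn η (Icc 0 1))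
    (hη0 : η 0 = 1) (hη1 : η 1 = 0) : Monotone (cumRate η) :=
  monotone_of_deriv_nonneg (fun x => (hasDerivAt_cumRate hη x).differentiableAt) fun x => by
    rw [(hasDerivAt_cumRate hη x).deriv]
    exact (rateExt_mem hη_anti hη0 hη1 x).1

lemma strictMonoOn_cumRate (hη : ContinuousOn η (Icc 0 1)) (hη_anti : StrictAntiOn η (Icc 0 1))
    (hη1 : η 1 = 0) : StrictMonoOn (cumRate η) (Icc 0 1) :=
  strictMonoOn_of_deriv_pos (convex_Icc 0 1) (continuous_cumRate hη).continuousOn fun x hx => by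
    rw [interior_Icc] at hx
    rw [(hasDerivAt_cumRate hη x).deriv, rateExt_of_mem (Ioo_subset_Icc_self hx), ← hη1]
    exact hη_anti (Ioo_subset_Icc_self hx) (right_mem_Icc.2 zero_le_one) hx.2

lemma strictConcaveOn_cumRate (hη : ContinuousOn η (Icc 0 1))
    (hη_anti : StrictAntiOn η (Icc 0 1)) : StrictConcaveOn ℝ (Icc 0 1) (cumRate η) := by
  refine StrictAntiOn.strictConcaveOn_of_deriv (convex_Icc 0 1)
    (continuous_cumRate hη).continuousOn ?_
  rw [interior_Icc]
  intro x hx y hy hxy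
  rw [(hasDerivAt_cumRate hη x).deriv, (hasDerivAt_cumRate hη y).deriv,
    rateExt_of_mem (Ioo_subset_Icc_self hx), rateExt_of_mem (Ioo_subset_Icc_self hy)]
  exact hη_anti (Ioo_subset_Icc_self hx) (Ioo_subset_Icc_self hy) hxy

/-- The mean-field right-hand side in terms of the primitive of the jump rate. -/
lemma mfmRHS_eq {J : Measure ℝ} [IsProbabilityMeasure J] (hJ0 : J (Iic 0) = 0)
    (hη : ContinuousOn η (Icc 0 1)) (hη_anti : StrictAntiOn η (Icc 0 1)) (hη0 : η 0 = 1)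
    (hη1 : η 1 = 0) {F : ℝ → ℝ} (hF : IsCDF F) (x : ℝ) :
    mfmRHS η J F x = -∫ u, (cumRate η (F x) - cumRate η (F (x - u))) ∂J := by
  classical
  let S : Set (ℝ × ℝ) := {p | F (x - p.2) < p.1 ∧ p.1 ≤ F x}
  have hS : MeasurableSet S :=
    (measurableSet_lt (hF.mono.measurable.comp (measurable_const.sub measurable_snd))
      measurable_fst).inter (measurableSet_le measurable_fst measurable_const)
  let g : ℝ × ℝ → ℝ := S.indicator fun p => rateExt η p.1
  have hg : Measurable g :=
    ((continuous_rateExt hη).measurable.comp measurable_fst).indicator hS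
  have hgb : ∀ p, ‖g p‖ ≤ 1 := fun p => by
    have h := rateExt_mem hη_anti hη0 hη1 p.1
    by_cases hp : p ∈ S
    · simp only [g, indicator_of_mem hp, Real.norm_eq_abs, abs_of_nonneg h.1, h.2]
    · simp [g, indicator_of_notMem hp]
  have hgi : Integrable (Function.uncurry fun ν u => g (ν, u))
      ((volume.restrict (Ioo (0 : ℝ) 1)).prod J) :=
    Integrable.of_bound hg.aestronglyMeasurable 1 (Eventually.of_forall fun p => hgb p)
  rw [mfmRHS, neg_inj]
  calc ∫ ν in Ioo (0 : ℝ) 1, η ν * (if quantile F ν ≤ x then Jbar J (x - quantile F ν) else 0)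
      = ∫ ν in Ioo (0 : ℝ) 1, ∫ u, g (ν, u) ∂J := by
        refine setIntegral_congr_fun measurableSet_Ioo fun ν hν => ?_
        have hq := hF.quantile_le_iff hν
        split_ifs with hx
        · have e : (fun u => g (ν, u)) = (Ioi (x - quantile F ν)).indicator fun _ => η ν := by
            funext u
            have : (ν, u) ∈ S ↔ u ∈ Ioi (x - quantile F ν) := by
              change F (x - u) < ν ∧ ν ≤ F x ↔ x - quantile F ν < u
              rw [← hq, ← not_le, ← hq, not_le]
              constructor
              · rintro ⟨h, -⟩
                linarith
              · exact fun h => ⟨by linarith, hx⟩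
            simp only [g, indicator_apply, this, rateExt_of_mem (Ioo_subset_Icc_self hν)]
          rw [e, integral_indicator_const _ measurableSet_Ioi, smul_eq_mul, mul_comm]
          rfl
        · have e : (fun u => g (ν, u)) = fun _ => 0 := by
            funext u
            refine indicator_of_notMem (fun h => hx ?_) _
            exact (hq x).2 h.2
          simp [e]
    _ = ∫ u, (∫ ν in Ioo (0 : ℝ) 1, g (ν, u)) ∂J := integral_integral_swap hgi
    _ = ∫ u, (cumRate η (F x) - cumRate η (F (x - u))) ∂J := by
        have : ∀ᵐ z ∂J, z ∉ Iic (0 : ℝ) := measure_eq_zero_iff_ae_notMem.1 hJ0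
        refine integral_congr_ae ?_
        filter_upwards [this] with u hu
        have hu : 0 ≤ u := (not_le.1 hu).le
        have hle : F (x - u) ≤ F x := hF.mono (by linarith)
        rw [cumRate_sub hη, intervalIntegral.integral_of_le hle, ← integral_Ioc_eq_integral_Ioo,
          ← integral_indicator measurableSet_Ioc, ← integral_indicator measurableSet_Ioc]
        congr 1
        funext ν
        have h0 := hF.nonneg (x - u)
        have h1 := hF.le_one x
        by_cases hν : ν ∈ Ioc (F (x - u)) (F x)
        · have hν' : ν ∈ Ioc (0 : ℝ) 1 := ⟨h0.trans_lt hν.1, hν.2.trans h1⟩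
          rw [indicator_of_mem hν, indicator_of_mem hν']
          exact indicator_of_mem (s := S) hν _
        · rw [indicator_of_notMem hν]
          by_cases hν' : ν ∈ Ioc (0 : ℝ) 1
          · rw [indicator_of_mem hν']
            exact indicator_of_notMem (s := S) hν _
          · rw [indicator_of_notMem hν']

end cumRate

/-- The properties of the normalized primitive of the jump rate used for traveling waves. -/
structure IsConcaveRate (h : ℝ → ℝ) : Prop where
  continuous : Continuous h
  monotone : Monotone h
  zero : h 0 = 0
  one : h 1 = 1
  strictConcaveOn : StrictConcaveOn ℝ (Icc 0 1) h
  strictMonoOn : StrictMonoOn h (Icc 0 1)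

lemma IsConcaveRate.nonneg {h : ℝ → ℝ} (hh : IsConcaveRate h) {u : ℝ} (hu : 0 ≤ u) : 0 ≤ h u :=
  hh.zero ▸ hh.monotone hu

lemma IsConcaveRate.le_one {h : ℝ → ℝ} (hh : IsConcaveRate h) {u : ℝ} (hu : u ≤ 1) : h u ≤ 1 :=
  hh.one ▸ hh.monotone hu

lemma cumRate_one_pos {η : ℝ → ℝ} (hη : ContinuousOn η (Icc 0 1))
    (hη_anti : StrictAntiOn η (Icc 0 1)) (hη1 : η 1 = 0) : 0 < cumRate η 1 := by
  have := strictMonoOn_cumRate hη hη_anti hη1 (left_mem_Icc.2 zero_le_one)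
    (right_mem_Icc.2 zero_le_one) zero_lt_one
  rwa [cumRate_zero] at this

/-- The primitive of the jump rate, normalized to equal `1` at `1`. -/
noncomputable def normRate (η : ℝ → ℝ) (u : ℝ) : ℝ := (cumRate η 1)⁻¹ * cumRate η u

lemma isConcaveRate_normRate {η : ℝ → ℝ} (hη : ContinuousOn η (Icc 0 1))
    (hη_anti : StrictAntiOn η (Icc 0 1)) (hη0 : η 0 = 1) (hη1 : η 1 = 0) :
    IsConcaveRate (normRate η) := by
  have hv := inv_pos.2 (cumRate_one_pos hη hη_anti hη1)
  refine ⟨continuous_const.mul (continuous_cumRate hη),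
    (monotone_cumRate hη hη_anti hη0 hη1).const_mul hv.le, ?_, ?_, ?_, ?_⟩
  · rw [normRate, cumRate_zero, mul_zero]
  · rw [normRate, inv_mul_cancel₀ (inv_pos.1 hv).ne']
  · refine ⟨convex_Icc 0 1, fun x hx y hy hxy a b ha hb hab => ?_⟩
    have := (strictConcaveOn_cumRate hη hη_anti).2 hx hy hxy ha hb hab
    simp only [smul_eq_mul, normRate] at this ⊢
    calc _ = (cumRate η 1)⁻¹ * (a * cumRate η x + b * cumRate η y) := by ring
      _ < _ := mul_lt_mul_of_pos_left this hv
  · exact fun x hx y hy hxy =>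
      mul_lt_mul_of_pos_left (strictMonoOn_cumRate hη hη_anti hη1 hx hy hxy) hv

/-- The integral equation satisfied by traveling wave shapes. -/
def IsWave (J : Measure ℝ) (h φ : ℝ → ℝ) : Prop :=
  ∀ x, φ x = ∫ z, h (φ (x - z)) ∂(excessLaw J)

section wave

variable {J : Measure ℝ} {h φ ψ : ℝ → ℝ}

lemma IsWave.lipschitz [IsProbabilityMeasure J] [IsProbabilityMeasure (excessLaw J)]
    (hJ : Integrable (fun z : ℝ => z) J) (hJ0 : J (Iic 0) = 0) (hh : IsConcaveRate h)
    (hφ : IsCDF φ) (hw : IsWave J h φ) : LipschitzWith 1 φ := by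
  refine LipschitzWith.of_dist_le_mul fun x y => ?_
  rw [NNReal.coe_one, one_mul, Real.dist_eq, Real.dist_eq, hw x, hw y]
  exact abs_integral_excessLaw_sub_le hJ hJ0 (G := fun x => h (φ x))
    (hh.continuous.measurable.comp hφ.mono.measurable)
    (fun x => hh.nonneg (hφ.nonneg x)) (fun x => hh.le_one (hφ.le_one x)) x y

lemma tendsto_integral_excessLaw {ι : Type*} {l : Filter ι} [l.IsCountablyGenerated]
    [IsProbabilityMeasure (excessLaw J)]
    {G : ι → ℝ → ℝ} {c : ℝ → ℝ} (hG : ∀ i, Measurable (G i)) {C : ℝ} (hC : ∀ i x, |G i x| ≤ C)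
    (hlim : ∀ z, Tendsto (fun i => G i z) l (𝓝 (c z))) :
    Tendsto (fun i => ∫ z, G i z ∂(excessLaw J)) l (𝓝 (∫ z, c z ∂(excessLaw J))) :=
  tendsto_integral_filter_of_dominated_convergence (fun _ => C)
    (Eventually.of_forall fun i => (hG i).aestronglyMeasurable)
    (Eventually.of_forall fun i => Eventually.of_forall fun z => hC i z)
    (integrable_const _) (Eventually.of_forall hlim)

/-- Two traveling waves of the same speed are ordered. -/
lemma IsWave.le_or_le [IsProbabilityMeasure J] [IsProbabilityMeasure (excessLaw J)]
    (hJ : Integrable (fun z : ℝ => z) J) (hJ0 : J (Iic 0) = 0) (hJpos : ∀ a, 0 < J (Ioi a))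
    (hh : IsConcaveRate h) (hφ : IsCDF φ) (hψ : IsCDF ψ)
    (hwφ : IsWave J h φ) (hwψ : IsWave J h ψ) : (∀ x, φ x ≤ ψ x) ∨ ∀ x, ψ x ≤ φ x := by
  have hcφ := (hwφ.lipschitz hJ hJ0 hh hφ).continuous
  have hcψ := (hwψ.lipschitz hJ hJ0 hh hψ).continuous
  have key : ∀ (D : ℝ → ℝ), Continuous D → (∀ x, |D x| ≤ 1) → Tendsto D atBot (𝓝 0) →
      (∀ x, 0 ≤ D x) → Tendsto (fun x => ∫ z, D (x - z) ∂(excessLaw J)) atBot (𝓝 0) ∧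
      (∀ x, 0 ≤ ∫ z, D (x - z) ∂(excessLaw J)) ∧
      (∀ x, D x = 0 → ∃ d ≤ 0, HasDerivAt (fun x => ∫ z, D (x - z) ∂(excessLaw J)) d x) ∧
      (Continuous fun x => ∫ z, D (x - z) ∂(excessLaw J)) ∧
      (∀ x y, 0 < D y → y < x → 0 < ∫ z, D (x - z) ∂(excessLaw J)) := by
    intro D hD hD1 hDlim hD0
    have hder := hasDerivAt_integral_excessLaw hJ hJ0 hD hD1
    refine ⟨?_, fun x => integral_nonneg fun z => hD0 _, fun x hx => ⟨_, ?_, hder x⟩,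
      continuous_iff_continuousAt.2 fun x => (hder x).continuousAt, fun x y hy hxy => ?_⟩
    · have := tendsto_integral_excessLaw (J := J) (l := atBot) (G := fun x z => D (x - z))
        (c := fun _ => 0) (fun x => (hD.comp (continuous_const.sub continuous_id)).measurable)
        (fun x z => hD1 _) (fun z => hDlim.comp (tendsto_atBot_add_const_right _ _ tendsto_id))
      simpa using this
    · refine integral_nonpos fun u => ?_
      have := hD0 (x - u)
      simp only [hx, Pi.zero_apply]
      linarith
    · rw [integral_excessLaw_comp_sub hJ0 hD.measurable hD1]
      have hae : ∀ᵐ z ∂J, z ∉ Iic (0 : ℝ) := measure_eq_zero_iff_ae_notMem.1 hJ0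
      rw [integral_pos_iff_support_of_nonneg_ae ?_
        (integrable_intervalIntegral_sub hJ hD.measurable hD1 x)]
      · refine (hJpos (x - y)).trans_le (measure_mono fun u hu => ?_)
        have hu : x - y < u := hu
        refine ne_of_gt (intervalIntegral.integral_pos (by linarith) hD.continuousOn
          (fun t _ => hD0 t) ⟨y, ⟨by linarith, hxy.le⟩, hy⟩)
      · filter_upwards [hae] with u hu
        have hu : 0 ≤ u := (not_le.1 hu).le
        exact intervalIntegral.integral_nonneg (by linarith) fun t _ => hD0 t
  let D : ℝ → ℝ := fun x => h (φ x) - h (ψ x)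
  have hDc : Continuous D := (hh.continuous.comp hcφ).sub (hh.continuous.comp hcψ)
  have hDle : ∀ x, |D x| ≤ 1 := fun x => by
    have a1 := hh.nonneg (hφ.nonneg x)
    have a2 := hh.nonneg (hψ.nonneg x)
    have a3 := hh.le_one (hφ.le_one x)
    have a4 := hh.le_one (hψ.le_one x)
    rw [abs_le]
    constructor <;> simp only [D] <;> linarith
  have hDlim : Tendsto D atBot (𝓝 0) := by
    have h1 := ((hh.continuous.tendsto 0).comp hφ.tendsto_atBot).sub
      ((hh.continuous.tendsto 0).comp hψ.tendsto_atBot)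
    simpa using h1
  obtain ⟨plim, p0, pder, pcont, ppos⟩ := key (fun x => max (D x) 0) (hDc.max continuous_const)
    (fun x => by
      rw [abs_of_nonneg (le_max_right _ _)]
      exact max_le ((le_abs_self _).trans (hDle x)) zero_le_one)
    (by simpa using hDlim.max (tendsto_const_nhds (x := (0 : ℝ)))) (fun x => le_max_right _ _)
  obtain ⟨qlim, q0, qder, qcont, qpos⟩ := key (fun x => max (-D x) 0) (hDc.neg.max continuous_const)
    (fun x => by
      rw [abs_of_nonneg (le_max_right _ _)]
      exact max_le ((neg_le_abs _).trans (hDle x)) zero_le_one)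
    (by simpa using hDlim.neg.max (tendsto_const_nhds (x := (0 : ℝ)))) (fun x => le_max_right _ _)
  set p := fun x => ∫ z, max (D (x - z)) 0 ∂(excessLaw J) with hp
  set q := fun x => ∫ z, max (-D (x - z)) 0 ∂(excessLaw J) with hq
  have hint : ∀ (G : ℝ → ℝ), Continuous G → (∀ x, |G x| ≤ 1) → ∀ x,
      Integrable (fun z => G (x - z)) (excessLaw J) := fun G hG hG1 x =>
    Integrable.of_bound (hG.comp (continuous_const.sub continuous_id)).aestronglyMeasurable 1
      (Eventually.of_forall fun z => hG1 _)
  have hpq : ∀ x, φ x - ψ x = p x - q x := by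
    intro x
    rw [hwφ x, hwψ x, ← integral_sub, ← integral_sub]
    · refine integral_congr_ae (Eventually.of_forall fun z => ?_)
      change D (x - z) = max (D (x - z)) 0 - max (-D (x - z)) 0
      rcases le_total (D (x - z)) 0 with hd | hd
      · rw [max_eq_right hd, max_eq_left (by linarith)]; ring
      · rw [max_eq_left hd, max_eq_right (by linarith)]; ring
    · refine hint (fun x => max (D x) 0) (hDc.max continuous_const) (fun x => ?_) x
      rw [abs_of_nonneg (le_max_right _ _)]
      exact max_le ((le_abs_self _).trans (hDle x)) zero_le_one
    · refine hint (fun x => max (-D x) 0) (hDc.neg.max continuous_const) (fun x => ?_) x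
      rw [abs_of_nonneg (le_max_right _ _)]
      exact max_le ((neg_le_abs _).trans (hDle x)) zero_le_one
    · refine hint (fun x => h (φ x)) (hh.continuous.comp hcφ) (fun x => ?_) x
      rw [abs_of_nonneg (hh.nonneg (hφ.nonneg x))]
      exact hh.le_one (hφ.le_one x)
    · refine hint (fun x => h (ψ x)) (hh.continuous.comp hcψ) (fun x => ?_) x
      rw [abs_of_nonneg (hh.nonneg (hψ.nonneg x))]
      exact hh.le_one (hψ.le_one x)
  have hslope : ∀ (f : ℝ → ℝ) (x d r : ℝ), HasDerivAt f d x → d ≤ 0 → min (p x) (q x) = f x →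
      (∀ z, min (p z) (q z) ≤ f z) → 0 < r →
      ∀ᶠ z in 𝓝[>] x, slope (fun z => min (p z) (q z)) x z < r := by
    intro f x d r hd hd0 hfx hle hr
    have h1 : ∀ᶠ z in 𝓝[>] x, slope f x z < r :=
      (hasDerivAt_iff_tendsto_slope.1 hd).mono_left (nhdsWithin_mono _ fun z hz => ne_of_gt hz)
        |>.eventually (gt_mem_nhds (hd0.trans_lt hr))
    filter_upwards [h1, self_mem_nhdsWithin] with z hz hxz
    have hxz : x < z := hxz
    refine lt_of_le_of_lt ?_ hz
    rw [slope_def_field, slope_def_field, hfx]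
    exact div_le_div_of_nonneg_right (sub_le_sub_right (hle z) _) (sub_pos.2 hxz).le
  have hanti : ∀ a b, a ≤ b → min (p b) (q b) ≤ min (p a) (q a) := by
    intro a b hab
    refine image_le_of_liminf_slope_right_le_deriv_boundary (a := a) (b := b)
      (B := fun _ => min (p a) (q a)) (B' := fun _ => 0) (f := fun x => min (p x) (q x))
      (pcont.min qcont).continuousOn le_rfl continuousOn_const
      (fun x _ => hasDerivWithinAt_const _ _ _) (fun x _ r hr => ?_) (right_mem_Icc.2 hab)
    refine Eventually.frequently ?_
    rcases le_total (p x) (q x) with hx | hx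
    · have hD : D x ≤ 0 := sub_nonpos.2 (hh.monotone (by linarith [hpq x]))
      obtain ⟨d, hd, hder⟩ := pder x (max_eq_right hD)
      exact hslope p x d r hder hd (min_eq_left hx) (fun z => min_le_left _ _) hr
    · have hD : 0 ≤ D x := sub_nonneg.2 (hh.monotone (by linarith [hpq x]))
      obtain ⟨d, hd, hder⟩ := qder x (max_eq_right (neg_nonpos.2 hD))
      exact hslope q x d r hder hd (min_eq_right hx) (fun z => min_le_right _ _) hr
  have hmin : ∀ x, min (p x) (q x) ≤ 0 := by
    intro x
    have hl : Tendsto (fun x => min (p x) (q x)) atBot (𝓝 0) := by simpa using plim.min qlim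
    exact ge_of_tendsto hl ((eventually_le_atBot x).mono fun a ha => hanti a x ha)
  have hnot : ¬∃ x y, 0 < D x ∧ 0 < -D y := by
    rintro ⟨x, y, hx, hy⟩
    have h1 := ppos (max x y + 1) x (lt_max_of_lt_left hx) (by linarith [le_max_left x y])
    have h2 := qpos (max x y + 1) y (lt_max_of_lt_left hy) (by linarith [le_max_right x y])
    exact absurd (hmin _) (not_le.2 (lt_min h1 h2))
  have hmem : ∀ {F : ℝ → ℝ}, IsCDF F → ∀ x, F x ∈ Icc (0 : ℝ) 1 := fun hF x =>
    ⟨hF.nonneg x, hF.le_one x⟩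
  by_contra! hcon
  obtain ⟨⟨x, hx⟩, ⟨y, hy⟩⟩ := hcon
  exact hnot ⟨x, y, sub_pos.2 (hh.strictMonoOn (hmem hψ x) (hmem hφ x) hx),
    neg_pos.2 (sub_neg.2 (hh.strictMonoOn (hmem hφ y) (hmem hψ y) hy))⟩

end wave

section waveMFM

variable {J : Measure ℝ} {η φ : ℝ → ℝ}

lemma IsCDF.comp_sub_const {F : ℝ → ℝ} (hF : IsCDF F) (c : ℝ) : IsCDF fun x => F (x - c) where
  mono := fun _ _ hxy => hF.mono (sub_le_sub_right hxy c)
  right_continuous := fun x => ContinuousWithinAt.comp (f := fun y => y - c)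
    (hF.right_continuous (x - c)) (continuous_id.sub continuous_const).continuousWithinAt
    fun _ hy => sub_le_sub_right (mem_Ici.1 hy) c
  tendsto_atBot := hF.tendsto_atBot.comp (tendsto_atBot_add_const_right _ _ tendsto_id)
  tendsto_atTop := hF.tendsto_atTop.comp (tendsto_atTop_add_const_right _ _ tendsto_id)

/-- The average over the excess law is differentiable with derivative given by the
mean-field right-hand side. -/
lemma hasDerivAt_integral_normRate [IsProbabilityMeasure J] [IsProbabilityMeasure (excessLaw J)]
    (hJ : Integrable (fun z : ℝ => z) J) (hJ0 : J (Iic 0) = 0)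
    (hη : ContinuousOn η (Icc 0 1)) (hη_anti : StrictAntiOn η (Icc 0 1)) (hη0 : η 0 = 1)
    (hη1 : η 1 = 0) (hφ : IsCDF φ) (hc : Continuous φ) (x : ℝ) :
    HasDerivAt (fun x => ∫ z, normRate η (φ (x - z)) ∂(excessLaw J))
      (-(cumRate η 1)⁻¹ * mfmRHS η J φ x) x := by
  have hh := isConcaveRate_normRate hη hη_anti hη0 hη1
  convert hasDerivAt_integral_excessLaw hJ hJ0 (G := fun x => normRate η (φ x))
    (hh.continuous.comp hc) (C := 1) (fun x => ?_) x using 1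
  · rw [mfmRHS_eq hJ0 hη hη_anti hη0 hη1 hφ, neg_mul_neg, ← integral_const_mul]
    simp only [normRate, mul_sub]
  · rw [abs_of_nonneg (hh.nonneg (hφ.nonneg x))]
    exact hh.le_one (hφ.le_one x)

/-- A traveling wave solution of the mean-field model solves the integral equation. -/
lemma isWave_of_isMFM [IsProbabilityMeasure J] [IsProbabilityMeasure (excessLaw J)]
    (hJ : Integrable (fun z : ℝ => z) J) (hJ0 : J (Iic 0) = 0)
    (hη : ContinuousOn η (Icc 0 1)) (hη_anti : StrictAntiOn η (Icc 0 1)) (hη0 : η 0 = 1)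
    (hη1 : η 1 = 0) (hφ : IsCDF φ)
    (hm : IsMFM η J fun x t => φ (x - cumRate η 1 * t)) : IsWave J (normRate η) φ := by
  have hv := cumRate_one_pos hη hη_anti hη1
  have hh := isConcaveRate_normRate hη hη_anti hη0 hη1
  obtain ⟨-, -, ⟨c, hc⟩, hd⟩ := hm
  have hlip : LipschitzWith (c * Real.toNNReal (cumRate η 1)⁻¹) φ := by
    refine LipschitzWith.of_dist_le_mul fun a b => ?_
    wlog hab : a ≤ b generalizing a b
    · rw [dist_comm, dist_comm a]
      exact this b a (le_of_not_ge hab)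
    have h := (hc b).dist_le_mul ((b - a) / cumRate η 1)
      (div_nonneg (sub_nonneg.2 hab) hv.le) 0 self_mem_Ici
    have e : b - cumRate η 1 * ((b - a) / cumRate η 1) = a := by
      field_simp
      ring
    beta_reduce at h
    rw [e, mul_zero, sub_zero] at h
    refine h.trans (le_of_eq ?_)
    rw [NNReal.coe_mul, Real.coe_toNNReal _ (inv_nonneg.2 hv.le), Real.dist_eq, Real.dist_eq,
      sub_zero, abs_div, abs_of_pos hv, abs_sub_comm, div_eq_inv_mul, mul_assoc]
  have hcont := hlip.continuous
  set W : ℝ → ℝ := fun x => ∫ z, normRate η (φ (x - z)) ∂(excessLaw J) with hW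
  have hWder := hasDerivAt_integral_normRate hJ hJ0 hη hη_anti hη0 hη1 hφ hcont
  have hb : ∀ x, 0 ≤ normRate η (φ x) ∧ normRate η (φ x) ≤ 1 := fun x =>
    ⟨hh.nonneg (hφ.nonneg x), hh.le_one (hφ.le_one x)⟩
  have hWlip : LipschitzWith 1 W := LipschitzWith.of_dist_le_mul fun x y => by
    rw [NNReal.coe_one, one_mul]
    exact abs_integral_excessLaw_sub_le hJ hJ0 (G := fun x => normRate η (φ x))
      (hh.continuous.comp hcont).measurable (fun x => (hb x).1) (fun x => (hb x).2) x y
  have hder : ∀ᵐ x, HasDerivAt (fun x => φ x - W x) 0 x := by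
    filter_upwards [hlip.ae_differentiableAt_real] with x hx
    have h1 := hx.hasDerivAt
    have h2 : HasDerivAt (fun t => φ (x + cumRate η 1 - cumRate η 1 * t))
        (deriv φ x * -cumRate η 1) 1 := by
      have h3 : HasDerivAt (fun t : ℝ => x + cumRate η 1 - cumRate η 1 * t) (-cumRate η 1) 1 := by
        simpa using ((hasDerivAt_id (1 : ℝ)).const_mul (cumRate η 1)).const_sub (x + cumRate η 1)
      have h4 : HasDerivAt φ (deriv φ x) (x + cumRate η 1 - cumRate η 1 * 1) := by
        rwa [mul_one, add_sub_cancel_right]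
      exact h4.comp (1 : ℝ) h3
    have h5 := hd (x + cumRate η 1) 1 zero_le_one _ h2.hasDerivWithinAt
    have h6 : mfmRHS η J (fun y => φ (y - cumRate η 1 * 1)) (x + cumRate η 1)
        = mfmRHS η J φ x := by
      rw [mfmRHS_eq hJ0 hη hη_anti hη0 hη1 hφ,
        mfmRHS_eq hJ0 hη hη_anti hη0 hη1 (hφ.comp_sub_const _)]
      simp only [mul_one, add_sub_cancel_right]
      refine congrArg _ (integral_congr_ae (Eventually.of_forall fun u => ?_))
      beta_reduce
      rw [show x + cumRate η 1 - u - cumRate η 1 = x - u by ring]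
    rw [h6] at h5
    have h7 : HasDerivAt (fun x => φ x - W x)
        (deriv φ x - -(cumRate η 1)⁻¹ * mfmRHS η J φ x) x := h1.sub (hWder x)
    have h8 : deriv φ x - -(cumRate η 1)⁻¹ * mfmRHS η J φ x = 0 := by
      rw [← h5]
      field_simp
      ring
    rwa [h8] at h7
  have hconst : ∀ a b, a ≤ b → φ a - W a = φ b - W b := by
    intro a b hab
    obtain ⟨C, hC⟩ := ((hlip.sub hWlip).lipschitzOnWith
      (s := uIcc a b)).absolutelyContinuousOnInterval.const_of_ae_hasDerivAt_zero
      (hder.mono fun x hx _ => hx)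
    have h1 := hC a left_mem_uIcc
    have h2 := hC b right_mem_uIcc
    exact h1.trans h2.symm
  have hWlim : Tendsto W atBot (𝓝 0) := by
    have := tendsto_integral_excessLaw (J := J) (l := atBot)
      (G := fun x z => normRate η (φ (x - z))) (c := fun _ => 0) (C := 1)
      (fun x => (hh.continuous.comp (hcont.comp (continuous_const.sub continuous_id))).measurable)
      (fun x z => by rw [abs_of_nonneg (hb _).1]; exact (hb _).2)
      (fun z => by
        have := (hh.continuous.tendsto 0).comp (hφ.tendsto_atBot.comp
          (tendsto_atBot_add_const_right _ (-z) tendsto_id))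
        rwa [hh.zero] at this)
    simpa using this
  intro x
  have hlim : Tendsto (fun y => φ y - W y) atBot (𝓝 0) := by
    simpa using hφ.tendsto_atBot.sub hWlim
  have h1 : Tendsto (fun y => φ y - W y) atBot (𝓝 (φ x - W x)) :=
    tendsto_const_nhds.congr' ((eventually_le_atBot x).mono fun a ha => (hconst a x ha).symm)
  exact sub_eq_zero.1 (tendsto_nhds_unique h1 hlim)

/-- A solution of the integral equation is a traveling wave solution of the mean-field model. -/
lemma isMFM_of_isWave [IsProbabilityMeasure J] [IsProbabilityMeasure (excessLaw J)]
    (hJ : Integrable (fun z : ℝ => z) J) (hJ0 : J (Iic 0) = 0)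
    (hη : ContinuousOn η (Icc 0 1)) (hη_anti : StrictAntiOn η (Icc 0 1)) (hη0 : η 0 = 1)
    (hη1 : η 1 = 0) (hφ : IsCDF φ) (hw : IsWave J (normRate η) φ) :
    IsMFM η J fun x t => φ (x - cumRate η 1 * t) := by
  have hv := cumRate_one_pos hη hη_anti hη1
  have hh := isConcaveRate_normRate hη hη_anti hη0 hη1
  have hlip := hw.lipschitz hJ hJ0 hh hφ
  refine ⟨fun t _ => hφ.comp_sub_const _, fun x s _ t _ hst => hφ.mono ?_,
    ⟨Real.toNNReal (cumRate η 1), fun x => LipschitzOnWith.of_dist_le_mul fun s _ t _ => ?_⟩,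
    fun x t ht d hd => ?_⟩
  · have := mul_le_mul_of_nonneg_left hst hv.le
    linarith
  · refine (hlip.dist_le_mul _ _).trans (le_of_eq ?_)
    rw [NNReal.coe_one, one_mul, Real.coe_toNNReal _ hv.le, Real.dist_eq, Real.dist_eq,
      show x - cumRate η 1 * s - (x - cumRate η 1 * t) = cumRate η 1 * (t - s) by ring,
      abs_mul, abs_of_pos hv, abs_sub_comm]
  · have hφt := hφ.comp_sub_const (cumRate η 1 * t)
    have hW : (fun x => ∫ z, normRate η (φ (x - z)) ∂(excessLaw J)) = φ :=
      funext fun x => (hw x).symm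
    have h1 := hasDerivAt_integral_normRate hJ hJ0 hη hη_anti hη0 hη1 hφ hlip.continuous
      (x - cumRate η 1 * t)
    rw [hW] at h1
    have h3 : HasDerivAt (fun t : ℝ => x - cumRate η 1 * t) (-cumRate η 1) t := by
      simpa using ((hasDerivAt_id t).const_mul (cumRate η 1)).const_sub x
    have h4 := (h1.comp t h3).hasDerivWithinAt (s := Ici 0)
    have h5 := (uniqueDiffOn_Ici (0 : ℝ) t ht).eq_deriv _ hd h4
    rw [h5, mfmRHS_eq hJ0 hη hη_anti hη0 hη1 hφ, mfmRHS_eq hJ0 hη hη_anti hη0 hη1 hφt]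
    simp only [sub_right_comm x (cumRate η 1 * t)]
    field_simp

end waveMFM

section existence

variable {J : Measure ℝ} {g h : ℝ → ℝ}

lemma IsConcaveRate.lt_apply (hh : IsConcaveRate h) {u : ℝ} (hu : u ∈ Ioo (0 : ℝ) 1) : u < h u := by
  have := hh.strictConcaveOn.2 (left_mem_Icc.2 zero_le_one) (right_mem_Icc.2 zero_le_one)
    zero_ne_one (sub_pos.2 hu.2) hu.1 (sub_add_cancel 1 u)
  simpa [hh.zero, hh.one] using this

lemma IsConcaveRate.eq_zero_or_one (hh : IsConcaveRate h) {u : ℝ} (h0 : 0 ≤ u) (h1 : u ≤ 1)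
    (hu : h u = u) : u = 0 ∨ u = 1 := by
  by_contra! hcon
  exact (hh.lt_apply ⟨lt_of_le_of_ne h0 hcon.1.symm, lt_of_le_of_ne h1 hcon.2⟩).ne hu.symm

/-- Concavity along rays from the origin. -/
lemma IsConcaveRate.mul_le (hh : IsConcaveRate h) {u w : ℝ} (h0 : 0 ≤ u) (huw : u ≤ w)
    (h1 : w ≤ 1) : h w * u ≤ h u * w := by
  rcases (h0.trans huw).eq_or_lt with hw | hw
  · have : u = 0 := le_antisymm (huw.trans hw.ge) h0
    simp [this, ← hw]
  have hc := hh.strictConcaveOn.concaveOn.2 (left_mem_Icc.2 zero_le_one)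
    (⟨hw.le, h1⟩ : w ∈ Icc (0 : ℝ) 1) (sub_nonneg.2 ((div_le_one hw).2 huw))
    (div_nonneg h0 hw.le) (sub_add_cancel 1 (u / w))
  simp only [smul_eq_mul, hh.zero, mul_zero, zero_add, div_mul_cancel₀ _ hw.ne'] at hc
  calc h w * u = u / w * h w * w := by field_simp
    _ ≤ h u * w := mul_le_mul_of_nonneg_right hc hw.le

lemma ae_excessLaw_pos : ∀ᵐ z ∂(excessLaw J), 0 < z := by
  have := measure_eq_zero_iff_ae_notMem.1 (excessLaw_Iic_zero (J := J))
  exact this.mono fun z hz => not_le.1 hz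

/-- A limit at infinity of a solution of the integral equation is a fixed point. -/
lemma eq_apply_of_tendsto [IsProbabilityMeasure (excessLaw J)] {l : Filter ℝ} [l.NeBot]
    [l.IsCountablyGenerated] (hl : ∀ z, Tendsto (fun x => x - z) l l)
    (hg : Continuous g) (hg1 : ∀ u ∈ Icc (0 : ℝ) 1, g u ∈ Icc (0 : ℝ) 1)
    {u : ℝ → ℝ} (hu : Measurable u) (hu1 : ∀ x, u x ∈ Icc (0 : ℝ) 1)
    (heq : ∀ x, u x = ∫ z, g (u (x - z)) ∂(excessLaw J)) {L : ℝ} (hL : Tendsto u l (𝓝 L)) :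
    g L = L := by
  have := tendsto_integral_excessLaw (J := J) (l := l) (G := fun x z => g (u (x - z)))
    (c := fun _ => g L) (C := 1)
    (fun x => hg.measurable.comp (hu.comp (measurable_const.sub measurable_id)))
    (fun x z => by
      have := hg1 _ (hu1 (x - z))
      rw [abs_of_nonneg this.1]
      exact this.2)
    (fun z => (hg.tendsto L).comp (hL.comp (hl z)))
  simp_rw [← heq] at this
  exact tendsto_nhds_unique (by simpa using this) hL

lemma integrable_comp_sub [IsProbabilityMeasure (excessLaw J)] (hg : Continuous g)
    (hg1 : ∀ u ∈ Icc (0 : ℝ) 1, g u ∈ Icc (0 : ℝ) 1)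
    {u : ℝ → ℝ} (hu : Measurable u) (hu1 : ∀ x, u x ∈ Icc (0 : ℝ) 1) (x : ℝ) :
    Integrable (fun z => g (u (x - z))) (excessLaw J) :=
  Integrable.of_bound (hg.measurable.comp (hu.comp
    (measurable_const.sub measurable_id))).aestronglyMeasurable 1 (Eventually.of_forall fun z => by
      have := hg1 _ (hu1 (x - z))
      rw [Real.norm_eq_abs, abs_of_nonneg this.1]
      exact this.2)

lemma integral_comp_sub_mono [IsProbabilityMeasure (excessLaw J)] (hg : Continuous g)
    (hg1 : ∀ u ∈ Icc (0 : ℝ) 1, g u ∈ Icc (0 : ℝ) 1) (hgm : Monotone g)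
    {u w : ℝ → ℝ} (hu : Measurable u) (hu1 : ∀ x, u x ∈ Icc (0 : ℝ) 1)
    (hw : Measurable w) (hw1 : ∀ x, w x ∈ Icc (0 : ℝ) 1) {x y : ℝ}
    (huw : ∀ z, u (x - z) ≤ w (y - z)) :
    ∫ z, g (u (x - z)) ∂(excessLaw J) ≤ ∫ z, g (w (y - z)) ∂(excessLaw J) :=
  integral_mono (integrable_comp_sub hg hg1 hu hu1 x) (integrable_comp_sub hg hg1 hw hw1 y)
    fun z => hgm (huw z)

lemma integral_comp_sub_mem [IsProbabilityMeasure (excessLaw J)]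
    (hg1 : ∀ u ∈ Icc (0 : ℝ) 1, g u ∈ Icc (0 : ℝ) 1)
    {u : ℝ → ℝ} (hu1 : ∀ x, u x ∈ Icc (0 : ℝ) 1) (x : ℝ) :
    ∫ z, g (u (x - z)) ∂(excessLaw J) ∈ Icc (0 : ℝ) 1 := by
  refine ⟨integral_nonneg fun z => (hg1 _ (hu1 _)).1, ?_⟩
  have := norm_integral_le_of_norm_le_const (μ := excessLaw J) (f := fun z => g (u (x - z)))
    (C := 1) (Eventually.of_forall fun z => by
      have := hg1 _ (hu1 (x - z))
      rw [Real.norm_eq_abs, abs_of_nonneg this.1]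
      exact this.2)
  simpa using (le_abs_self _).trans this

lemma exists_least_fixedPoint {α : Type*} [CompleteLattice α] (S : α → α) (hS : Monotone S) :
    ∃ a, S a = a ∧ ∀ b, S b ≤ b → a ≤ b :=
  ⟨OrderHom.lfp ⟨S, hS⟩, OrderHom.map_lfp ⟨S, hS⟩, fun _ hb => OrderHom.lfp_le ⟨S, hS⟩ hb⟩

/-- A monotone solution between an ordered pair of sub- and supersolutions. -/
lemma exists_solution_between [IsProbabilityMeasure (excessLaw J)] (hg : Continuous g)
    (hg1 : ∀ u ∈ Icc (0 : ℝ) 1, g u ∈ Icc (0 : ℝ) 1) (hgm : Monotone g)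
    {lo hi : ℝ → ℝ} (hlo : Monotone lo) (hhi : Monotone hi) (hlo1 : ∀ x, lo x ∈ Icc (0 : ℝ) 1)
    (hhi1 : ∀ x, hi x ∈ Icc (0 : ℝ) 1) (hle : ∀ x, lo x ≤ hi x)
    (hsub : ∀ x, lo x ≤ ∫ z, g (lo (x - z)) ∂(excessLaw J))
    (hsuper : ∀ x, ∫ z, g (hi (x - z)) ∂(excessLaw J) ≤ hi x) :
    ∃ u : ℝ → ℝ, Monotone u ∧ (∀ x, u x ∈ Icc (0 : ℝ) 1) ∧ (∀ x, lo x ≤ u x) ∧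
      (∀ x, u x ≤ hi x) ∧ ∀ x, u x = ∫ z, g (u (x - z)) ∂(excessLaw J) := by
  have : Fact ((0 : ℝ) ≤ 1) := ⟨zero_le_one⟩
  have hmeas : ∀ f : ℝ →o Icc (0 : ℝ) 1, Measurable fun x => (f x : ℝ) := fun f =>
    Monotone.measurable (f := fun x => (f x : ℝ)) fun x y hxy => f.monotone hxy
  let T : (ℝ →o Icc (0 : ℝ) 1) →o (ℝ →o Icc (0 : ℝ) 1) :=
    { toFun := fun f =>
        { toFun := fun x => ⟨∫ z, g (f (x - z)) ∂(excessLaw J),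
            integral_comp_sub_mem (u := fun x => (f x : ℝ)) hg1 (fun x => (f x).2) x⟩
          monotone' := fun x y hxy => integral_comp_sub_mono hg hg1 hgm (hmeas f)
            (fun x => (f x).2) (hmeas f) (fun x => (f x).2)
            fun z => f.monotone (sub_le_sub_right hxy z) }
      monotone' := fun f f' hff x => integral_comp_sub_mono hg hg1 hgm (hmeas f)
            (fun x => (f x).2) (hmeas f') (fun x => (f' x).2) fun z => hff (x - z) }
  let lo' : ℝ →o Icc (0 : ℝ) 1 := ⟨fun x => ⟨lo x, hlo1 x⟩, fun x y hxy => hlo hxy⟩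
  let hi' : ℝ →o Icc (0 : ℝ) 1 := ⟨fun x => ⟨hi x, hhi1 x⟩, fun x y hxy => hhi hxy⟩
  obtain ⟨u, hfix, hleast⟩ := exists_least_fixedPoint (fun f => T f ⊔ lo')
    fun f f' hff => sup_le_sup_right (T.monotone hff) _
  have h1 : lo' ≤ u := by
    rw [← hfix]
    exact le_sup_right
  have h2 : lo' ≤ T u := le_trans (fun x => hsub x) (T.monotone h1)
  rw [sup_eq_left.2 h2] at hfix
  have h3 : u ≤ hi' := hleast _ (sup_le (fun x => hsuper x) fun x => hle x)
  refine ⟨fun x => (u x : ℝ), fun x y hxy => u.monotone hxy, fun x => (u x).2,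
    fun x => h1 x, fun x => h3 x, fun x => ?_⟩
  exact (congrArg (fun f : ℝ →o Icc (0 : ℝ) 1 => (f x : ℝ)) hfix).symm

/-- The Laplace transform of the excess law takes all values in `(0, 1)`. -/
lemma exists_laplace_eq [IsProbabilityMeasure (excessLaw J)] {s : ℝ} (hs : 1 < s) :
    ∃ a > 0, s * ∫ z, Real.exp (-(a * z)) ∂(excessLaw J) = 1 := by
  let M : ℝ → ℝ := fun a => ∫ z, Real.exp (-(a * z)) ∂(excessLaw J)
  have hbound : ∀ a ∈ Ici (0 : ℝ), ∀ᵐ z ∂(excessLaw J), ‖Real.exp (-(a * z))‖ ≤ 1 := by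
    intro a ha
    filter_upwards [ae_excessLaw_pos] with z hz
    rw [Real.norm_eq_abs, Real.abs_exp, Real.exp_le_one_iff]
    exact neg_nonpos.2 (mul_nonneg ha hz.le)
  have hmeas : ∀ a : ℝ, AEStronglyMeasurable (fun z => Real.exp (-(a * z))) (excessLaw J) :=
    fun a =>
    (by fun_prop : Continuous fun z => Real.exp (-(a * z))).aestronglyMeasurable
  have hcont : ContinuousOn M (Ici 0) := continuousOn_of_dominated (bound := fun _ => 1)
    (fun a _ => hmeas a) hbound (integrable_const _)
    (Eventually.of_forall fun z => by fun_prop)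
  have hM0 : M 0 = 1 := by simp [M]
  have hlim : Tendsto M atTop (𝓝 0) := by
    have := tendsto_integral_filter_of_dominated_convergence (μ := excessLaw J) (l := atTop)
      (F := fun a z => Real.exp (-(a * z))) (f := fun _ => 0) (fun _ => 1)
      (Eventually.of_forall hmeas)
      ((eventually_ge_atTop 0).mono hbound) (integrable_const _) (by
        filter_upwards [ae_excessLaw_pos] with z hz
        exact Real.tendsto_exp_neg_atTop_nhds_zero.comp (tendsto_id.atTop_mul_const hz))
    simpa using this
  have hspos : 0 < s := zero_lt_one.trans hs
  obtain ⟨b, hb, hb0⟩ := ((hlim.eventually (gt_mem_nhds (inv_pos.2 hspos))).and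
    (eventually_ge_atTop 0)).exists
  obtain ⟨a, ha, haM⟩ := intermediate_value_Icc' hb0 (hcont.mono fun x hx => hx.1)
    (⟨hb.le, hM0 ▸ inv_le_one_of_one_le₀ hs.le⟩ : s⁻¹ ∈ Icc (M b) (M 0))
  refine ⟨a, lt_of_le_of_ne ha.1 ?_, ?_⟩
  · rintro rfl
    rw [hM0] at haM
    exact (inv_lt_one_of_one_lt₀ hs).ne haM.symm
  · change s * M a = 1
    rw [haM, mul_inv_cancel₀ hspos.ne']

/-- Traveling waves for a nonlinearity that is linear near `0` and uniformly close to `h`. -/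
lemma exists_approx_wave [IsProbabilityMeasure J] [IsProbabilityMeasure (excessLaw J)]
    (hJ : Integrable (fun z : ℝ => z) J) (hJ0 : J (Iic 0) = 0) (hh : IsConcaveRate h)
    {ε : ℝ} (hε : ε ∈ Ioo (0 : ℝ) 1) :
    ∃ g w : ℝ → ℝ, Continuous g ∧ (∀ u ∈ Icc (0 : ℝ) 1, g u ∈ Icc (0 : ℝ) 1) ∧
      (∀ u ∈ Icc (0 : ℝ) 1, |g u - h u| ≤ h ε) ∧ Monotone w ∧ (∀ x, w x ∈ Icc (0 : ℝ) 1) ∧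
      LipschitzWith 1 w ∧ w 0 = 1 / 2 ∧ ∀ x, w x = ∫ z, g (w (x - z)) ∂(excessLaw J) := by
  set s := h ε / ε with hs
  have hs1 : 1 < s := (one_lt_div hε.1).2 (hh.lt_apply hε)
  have hs0 : 0 < s := zero_lt_one.trans hs1
  have hsε : s * ε = h ε := div_mul_cancel₀ _ hε.1.ne'
  let g : ℝ → ℝ := fun u => min (s * u) (h u)
  have hgc : Continuous g := (continuous_const.mul continuous_id).min hh.continuous
  have hgm : Monotone g := (monotone_id.const_mul hs0.le).min hh.monotone
  have hg1 : ∀ u ∈ Icc (0 : ℝ) 1, g u ∈ Icc (0 : ℝ) 1 := fun u hu =>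
    ⟨le_min (mul_nonneg hs0.le hu.1) (hh.nonneg hu.1), (min_le_right _ _).trans (hh.le_one hu.2)⟩
  have hlin : ∀ u, 0 ≤ u → u ≤ ε → g u = s * u := fun u h0 h1 => by
    refine min_eq_left ?_
    have := hh.mul_le h0 h1 hε.2.le
    rw [hs, div_mul_eq_mul_div, div_le_iff₀ hε.1]
    exact this
  have hgh : ∀ u, ε ≤ u → u ≤ 1 → g u = h u := fun u h0 h1 => by
    refine min_eq_right ?_
    have := hh.mul_le hε.1.le h0 h1
    rw [hs, div_mul_eq_mul_div, le_div_iff₀ hε.1]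
    exact this
  obtain ⟨a, ha, hlap⟩ := exists_laplace_eq (J := J) hs1
  let lo : ℝ → ℝ := fun x => ε * Real.exp (a * min x 0)
  let hi : ℝ → ℝ := fun x => min (ε * Real.exp (a * x)) 1
  have hexp : ∀ x, Real.exp (a * min x 0) ≤ 1 := fun x =>
    Real.exp_le_one_iff.2 (mul_nonpos_of_nonneg_of_nonpos ha.le (min_le_right _ _))
  have hloε : ∀ x, lo x ≤ ε := fun x => mul_le_of_le_one_right hε.1.le (hexp x)
  have hlom : Monotone lo := fun x y hxy => mul_le_mul_of_nonneg_left (Real.exp_le_exp.2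
    (mul_le_mul_of_nonneg_left (min_le_min_right _ hxy) ha.le)) hε.1.le
  have hhim : Monotone hi := fun x y hxy => min_le_min_right _ (mul_le_mul_of_nonneg_left
    (Real.exp_le_exp.2 (mul_le_mul_of_nonneg_left hxy ha.le)) hε.1.le)
  have hlo1 : ∀ x, lo x ∈ Icc (0 : ℝ) 1 := fun x =>
    ⟨mul_nonneg hε.1.le (Real.exp_pos _).le, (hloε x).trans hε.2.le⟩
  have hhi1 : ∀ x, hi x ∈ Icc (0 : ℝ) 1 := fun x =>
    ⟨le_min (mul_nonneg hε.1.le (Real.exp_pos _).le) zero_le_one, min_le_right _ _⟩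
  have hexpint : ∀ x : ℝ, ∫ z, s * (ε * Real.exp (a * (x - z))) ∂(excessLaw J)
      = ε * Real.exp (a * x) := fun x => by
    have e : ∀ z, s * (ε * Real.exp (a * (x - z)))
        = ε * Real.exp (a * x) * s * Real.exp (-(a * z)) := fun z => by
      rw [mul_sub, sub_eq_add_neg, Real.exp_add]
      ring
    simp_rw [e]
    rw [integral_const_mul, mul_assoc, hlap, mul_one]
  have hexpi : ∀ x : ℝ, Integrable (fun z => s * (ε * Real.exp (a * (x - z)))) (excessLaw J) :=
    fun x => by
      refine Integrable.of_bound (by fun_prop) (s * (ε * Real.exp (a * x))) ?_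
      filter_upwards [ae_excessLaw_pos] with z hz
      rw [Real.norm_eq_abs, abs_of_nonneg (by have := hε.1; positivity)]
      have := hε.1
      gcongr
      linarith
  obtain ⟨u, hum, hu1, hlou, huhi, hueq⟩ := exists_solution_between (J := J) hgc hg1 hgm hlom hhim
    hlo1 hhi1
    (fun x => le_min (mul_le_mul_of_nonneg_left (Real.exp_le_exp.2
      (mul_le_mul_of_nonneg_left (min_le_left _ _) ha.le)) hε.1.le) (hlo1 x).2)
    (fun x => by
      have h1 : lo x = ∫ z, g (lo (min x 0 - z)) ∂(excessLaw J) := by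
        change ε * Real.exp (a * min x 0) = _
        rw [← hexpint]
        refine integral_congr_ae ?_
        filter_upwards [ae_excessLaw_pos] with z hz
        rw [hlin _ (hlo1 _).1 (hloε _)]
        simp only [lo]
        rw [min_eq_left (by linarith [min_le_right x 0] : min x 0 - z ≤ 0)]
      rw [h1]
      exact integral_comp_sub_mono hgc hg1 hgm hlom.measurable hlo1 hlom.measurable hlo1
        fun z => hlom (sub_le_sub_right (min_le_left _ _) z))
    (fun x => by
      refine le_min ?_ (integral_comp_sub_mem hg1 hhi1 x).2
      rw [← hexpint]
      exact integral_mono (integrable_comp_sub hgc hg1 hhim.measurable hhi1 x) (hexpi x) fun z =>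
        (min_le_left _ _).trans (mul_le_mul_of_nonneg_left (min_le_left _ _) hs0.le))
  have hulip : LipschitzWith 1 u := LipschitzWith.of_dist_le_mul fun x y => by
    rw [NNReal.coe_one, one_mul, Real.dist_eq, Real.dist_eq, hueq x, hueq y]
    exact abs_integral_excessLaw_sub_le hJ hJ0 (G := fun x => g (u x))
      (hgc.measurable.comp hum.measurable) (fun x => (hg1 _ (hu1 x)).1) (fun x => (hg1 _ (hu1 x)).2)
      x y
  have hbot : Tendsto u atBot (𝓝 0) := by
    refine tendsto_of_tendsto_of_tendsto_of_le_of_le tendsto_const_nhds ?_ (fun x => (hu1 x).1)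
      (fun x => (huhi x).trans (min_le_left _ _))
    have := (Real.tendsto_exp_atBot.comp (tendsto_id.const_mul_atBot ha)).const_mul ε
    simpa using this
  have htop : Tendsto u atTop (𝓝 1) := by
    have h1 := tendsto_atTop_ciSup hum ⟨1, by rintro _ ⟨x, rfl⟩; exact (hu1 x).2⟩
    set L := ⨆ x, u x
    have hL1 : L ≤ 1 := le_of_tendsto' h1 fun x => (hu1 x).2
    have hLε : ε ≤ L := by
      have h2 := hum.ge_of_tendsto h1 0
      have h3 := hlou 0
      simp only [lo, min_self, mul_zero, Real.exp_zero, mul_one] at h3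
      exact h3.trans h2
    have hfix := eq_apply_of_tendsto (J := J) (l := atTop)
      (fun z => tendsto_atTop_add_const_right _ (-z) tendsto_id)
      hgc hg1 hum.measurable hu1 hueq h1
    rw [hgh L hLε hL1] at hfix
    rcases hh.eq_zero_or_one (hε.1.le.trans hLε) hL1 hfix with h0 | h0
    · exact absurd (h0 ▸ hLε) (not_le.2 hε.1)
    · rwa [h0] at h1
  obtain ⟨c, hc⟩ : ∃ c, u c = 1 / 2 := by
    obtain ⟨x, hx⟩ := (hbot.eventually (gt_mem_nhds (by norm_num : (0 : ℝ) < 1 / 2))).exists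
    obtain ⟨y, hy⟩ := (htop.eventually (lt_mem_nhds (by norm_num : (1 / 2 : ℝ) < 1))).exists
    exact mem_range_of_exists_le_of_exists_ge hulip.continuous ⟨x, hx.le⟩ ⟨y, hy.le⟩
  refine ⟨g, fun x => u (x + c), hgc, hg1, fun t ht => ?_, fun x y hxy => hum (by linarith),
    fun x => hu1 _, LipschitzWith.of_dist_le_mul fun x y => ?_, by simpa using hc, fun x => ?_⟩
  · rcases le_total t ε with h1 | h1
    · have h2 := hg1 t ht
      have h3 := hh.monotone h1
      have h4 : g t ≤ h t := min_le_right _ _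
      rw [abs_le]
      constructor <;> linarith [h2.1]
    · rw [hgh t h1 ht.2, sub_self, abs_zero]
      exact hh.nonneg hε.1.le
  · have := hulip.dist_le_mul (x + c) (y + c)
    rwa [dist_add_right] at this
  · beta_reduce
    rw [hueq]
    simp only [sub_add_eq_add_sub]

end existence

section limit

/-- Pointwise sequential compactness of bounded `1`-Lipschitz functions. -/
lemma exists_subseq_tendsto_of_lipschitz {w : ℕ → ℝ → ℝ} (hlip : ∀ n, LipschitzWith 1 (w n))
    (hw1 : ∀ n x, w n x ∈ Icc (0 : ℝ) 1) :
    ∃ (φ : ℝ → ℝ) (k : ℕ → ℕ), StrictMono k ∧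
      ∀ x, Tendsto (fun n => w (k n) x) atTop (𝓝 (φ x)) := by
  obtain ⟨a, k, hk, hlim⟩ := CompactSpace.tendsto_subseq
    (fun n (q : ℚ) => (⟨w n q, hw1 n q⟩ : Icc (0 : ℝ) 1))
  have hq : ∀ q : ℚ, CauchySeq fun n => w (k n) q := fun q =>
    (((continuous_subtype_val.tendsto _).comp (tendsto_pi_nhds.1 hlim q))).cauchySeq
  have hdist : ∀ n x y, |w n x - w n y| ≤ |x - y| := fun n x y => by
    have := (hlip n).dist_le_mul x y
    simpa [Real.dist_eq] using this
  have hx : ∀ x, ∃ c, Tendsto (fun n => w (k n) x) atTop (𝓝 c) := fun x => by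
    refine cauchySeq_tendsto_of_complete (Metric.cauchySeq_iff'.2 fun ε hε => ?_)
    obtain ⟨q, hq1, hq2⟩ := exists_rat_btwn (show x < x + ε / 3 by linarith)
    obtain ⟨N, hN⟩ := Metric.cauchySeq_iff'.1 (hq q) (ε / 3) (by linarith)
    refine ⟨N, fun n hn => ?_⟩
    have h1 := abs_le.1 (hdist (k n) x q)
    have h2 := abs_le.1 (hdist (k N) x q)
    have h3 := abs_lt.1 (hN n hn)
    rw [abs_of_neg (sub_neg.2 hq1)] at h1 h2
    rw [Real.dist_eq, abs_lt]
    constructor <;> linarith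
  choose φ hφ using hx
  exact ⟨φ, k, hk, hφ⟩

variable {J : Measure ℝ} {h : ℝ → ℝ}

/-- Existence of a traveling wave. -/
lemma exists_isWave [IsProbabilityMeasure J] [IsProbabilityMeasure (excessLaw J)]
    (hJ : Integrable (fun z : ℝ => z) J) (hJ0 : J (Iic 0) = 0) (hh : IsConcaveRate h) :
    ∃ φ, IsCDF φ ∧ IsWave J h φ ∧ φ 0 = 1 / 2 := by
  let ε : ℕ → ℝ := fun n => 1 / ((n : ℝ) + 2)
  have hε : ∀ n, ε n ∈ Ioo (0 : ℝ) 1 := fun n => by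
    have : (0 : ℝ) ≤ n := n.cast_nonneg
    exact ⟨by positivity, (div_lt_one (by positivity)).2 (by linarith)⟩
  choose g w hgc hg1 hgh hwm hw1 hwl hw0 hweq using fun n =>
    exists_approx_wave (J := J) hJ hJ0 hh (hε n)
  obtain ⟨φ, k, hk, hφ⟩ := exists_subseq_tendsto_of_lipschitz hwl hw1
  have hφm : Monotone φ := fun x y hxy =>
    le_of_tendsto_of_tendsto' (hφ x) (hφ y) fun n => hwm _ hxy
  have hφ1 : ∀ x, φ x ∈ Icc (0 : ℝ) 1 := fun x =>
    isClosed_Icc.mem_of_tendsto (hφ x) (Eventually.of_forall fun n => hw1 _ x)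
  have hφ0 : φ 0 = 1 / 2 :=
    tendsto_nhds_unique (hφ 0) (by simp only [hw0]; exact tendsto_const_nhds)
  have hεlim : Tendsto (fun n => h (ε (k n))) atTop (𝓝 0) := by
    have h1 : Tendsto ε atTop (𝓝 0) := by
      have := (tendsto_const_nhds (x := (1 : ℝ))).div_atTop
        (tendsto_atTop_add_const_right _ (2 : ℝ) tendsto_natCast_atTop_atTop)
      exact this
    have := ((hh.continuous.tendsto 0).comp h1).comp hk.tendsto_atTop
    rwa [hh.zero] at this
  have hw : IsWave J h φ := fun x => by
    refine tendsto_nhds_unique (hφ x) ?_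
    have : ∀ n, w (k n) x = ∫ z, g (k n) (w (k n) (x - z)) ∂(excessLaw J) := fun n => hweq _ _
    simp only [this]
    refine tendsto_integral_excessLaw (C := 1)
      (fun n => (hgc _).measurable.comp ((hwm _).measurable.comp
        (measurable_const.sub measurable_id))) (fun n z => ?_) fun z => ?_
    · have := hg1 (k n) _ (hw1 (k n) (x - z))
      rw [abs_of_nonneg this.1]
      exact this.2
    · have h1 : Tendsto (fun n => h (w (k n) (x - z))) atTop (𝓝 (h (φ (x - z)))) :=
        (hh.continuous.tendsto _).comp (hφ (x - z))
      have h2 : Tendsto (fun n => g (k n) (w (k n) (x - z)) - h (w (k n) (x - z))) atTop (𝓝 0) :=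
        squeeze_zero_norm (fun n => hgh _ _ (hw1 _ _)) hεlim
      simpa using h2.add h1
  have hrange : ∀ u ∈ Icc (0 : ℝ) 1, h u ∈ Icc (0 : ℝ) 1 := fun u hu =>
    ⟨hh.nonneg hu.1, hh.le_one hu.2⟩
  have htop := tendsto_atTop_ciSup hφm ⟨1, by rintro _ ⟨x, rfl⟩; exact (hφ1 x).2⟩
  have hbot := tendsto_atBot_ciInf hφm ⟨0, by rintro _ ⟨x, rfl⟩; exact (hφ1 x).1⟩
  have htopfix := eq_apply_of_tendsto (J := J) (l := atTop)
    (fun z => tendsto_atTop_add_const_right _ (-z) tendsto_id)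
    hh.continuous hrange hφm.measurable hφ1 hw htop
  have hbotfix := eq_apply_of_tendsto (J := J) (l := atBot)
    (fun z => tendsto_atBot_add_const_right _ (-z) tendsto_id)
    hh.continuous hrange hφm.measurable hφ1 hw hbot
  have htop1 := isClosed_Icc.mem_of_tendsto htop (Eventually.of_forall hφ1)
  have hbot1 := isClosed_Icc.mem_of_tendsto hbot (Eventually.of_forall hφ1)
  have htop2 := hφm.ge_of_tendsto htop 0
  have hbot2 := hφm.le_of_tendsto hbot 0
  have hlip : LipschitzWith 1 φ := LipschitzWith.of_dist_le_mul fun x y => by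
    rw [NNReal.coe_one, one_mul, Real.dist_eq, Real.dist_eq, hw x, hw y]
    exact abs_integral_excessLaw_sub_le hJ hJ0 (G := fun x => h (φ x))
      (hh.continuous.measurable.comp hφm.measurable) (fun x => (hrange _ (hφ1 x)).1)
      (fun x => (hrange _ (hφ1 x)).2) x y
  refine ⟨φ, ⟨hφm, fun x => hlip.continuous.continuousWithinAt, ?_, ?_⟩, hw, hφ0⟩
  · rcases hh.eq_zero_or_one hbot1.1 hbot1.2 hbotfix with h0 | h0
    · rwa [h0] at hbot
    · linarith
  · rcases hh.eq_zero_or_one htop1.1 htop1.2 htopfix with h0 | h0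
    · linarith
    · rwa [h0] at htop

end limit

section renewal

variable {μ : Measure ℝ} {χ : ℝ} {Q : ℝ → ℝ≥0∞} {K : ℝ≥0∞}

lemma lintegral_add_const_rpow_ne_top [IsProbabilityMeasure μ] {p : ℝ} (hp : 1 ≤ p)
    (hmom : ∫⁻ z, ENNReal.ofReal z ^ p ∂μ ≠ ∞) (L : ℝ) :
    ∫⁻ z, ENNReal.ofReal (z + L) ^ p ∂μ ≠ ∞ := by
  have hp0 : 0 ≤ p := zero_le_one.trans hp
  have hle : ∫⁻ z, ENNReal.ofReal (z + L) ^ p ∂μ ≤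
      ∫⁻ z, 2 ^ (p - 1) * (ENNReal.ofReal z ^ p + ENNReal.ofReal L ^ p) ∂μ :=
    lintegral_mono fun z => (ENNReal.rpow_le_rpow ENNReal.ofReal_add_le hp0).trans
      (ENNReal.rpow_add_le_mul_rpow_add_rpow _ _ hp)
  refine (hle.trans_lt ?_).ne
  rw [lintegral_const_mul _ (by fun_prop), lintegral_add_right _ measurable_const, lintegral_const]
  refine ENNReal.mul_lt_top (ENNReal.rpow_lt_top_of_nonneg (by linarith) (by simp))
    (ENNReal.add_lt_top.2 ⟨hmom.lt_top, ENNReal.mul_lt_top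
      (ENNReal.rpow_lt_top_of_nonneg hp0 ENNReal.ofReal_ne_top) (measure_lt_top _ _)⟩)

/-- The multiplicative cost of a jump becomes negligible far away. -/
lemma exists_mul_lintegral_rpow_lt_one [IsProbabilityMeasure μ] (hpos : ∀ᵐ z ∂μ, 0 < z)
    (hχ : 0 < χ) (hmom : ∫⁻ z, ENNReal.ofReal z ^ (1 + χ) ∂μ ≠ ∞) (hK : K < 1) :
    ∃ L : ℝ, 0 < L ∧ K * ∫⁻ z, ENNReal.ofReal (1 + z / L) ^ χ ∂μ < 1 := by
  have hlim : Tendsto (fun n : ℕ => ∫⁻ z, ENNReal.ofReal (1 + z / ((n : ℝ) + 1)) ^ χ ∂μ) atTop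
      (𝓝 (∫⁻ _, 1 ∂μ)) := by
    refine tendsto_lintegral_of_dominated_convergence
      (fun z => ENNReal.ofReal (z + 1) ^ (1 + χ)) (fun n => by fun_prop) (fun n => ?_)
      (lintegral_add_const_rpow_ne_top (by linarith) hmom 1) ?_
    · filter_upwards [hpos] with z hz
      have hn : (1 : ℝ) ≤ (n : ℝ) + 1 := by linarith [(n.cast_nonneg : (0 : ℝ) ≤ n)]
      have h1 : 1 + z / ((n : ℝ) + 1) ≤ z + 1 := by linarith [div_le_self hz.le hn]
      refine (ENNReal.rpow_le_rpow (ENNReal.ofReal_le_ofReal h1) hχ.le).trans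
        (ENNReal.rpow_le_rpow_of_exponent_le ?_ (by linarith))
      rw [ENNReal.one_le_ofReal]
      linarith
    · refine Eventually.of_forall fun z => ?_
      have h1 : Tendsto (fun n : ℕ => 1 + z / ((n : ℝ) + 1)) atTop (𝓝 1) := by
        have := (tendsto_const_nhds (x := z)).div_atTop
          (tendsto_atTop_add_const_right _ (1 : ℝ) tendsto_natCast_atTop_atTop)
        simpa using this.const_add 1
      have h2 := ((ENNReal.continuous_rpow_const (y := χ)).tendsto _).comp
        (ENNReal.tendsto_ofReal h1)
      simpa [Function.comp_def] using h2
  have hmul := ENNReal.Tendsto.const_mul (a := K) hlim (Or.inr hK.ne_top)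
  simp only [lintegral_one, measure_univ, mul_one] at hmul
  obtain ⟨n, hn⟩ := (hmul.eventually (gt_mem_nhds hK)).exists
  exact ⟨n + 1, by positivity, hn⟩

lemma lintegral_rpow_mul_measure_Ici_ne_top [IsProbabilityMeasure μ] (hχ : 0 < χ)
    (hmom : ∫⁻ z, ENNReal.ofReal z ^ (1 + χ) ∂μ ≠ ∞) {L : ℝ} (hL : 0 < L) :
    ∫⁻ y in Ioi (0 : ℝ), ENNReal.ofReal (y + L) ^ χ * μ (Ici y) ≠ ∞ := by
  have hset : MeasurableSet {p : ℝ × ℝ | p.1 ≤ p.2} :=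
    measurableSet_le measurable_fst measurable_snd
  have hrw : ∀ y, ENNReal.ofReal (y + L) ^ χ * μ (Ici y) =
      ∫⁻ z, {p : ℝ × ℝ | p.1 ≤ p.2}.indicator
        (fun p => ENNReal.ofReal (p.1 + L) ^ χ) (y, z) ∂μ := by
    intro y
    rw [← setLIntegral_const, ← lintegral_indicator measurableSet_Ici]
    rfl
  simp only [hrw]
  rw [lintegral_lintegral_swap]
  swap
  · exact (Measurable.indicator (by fun_prop) hset).aemeasurable
  refine ((lintegral_mono fun z => ?_).trans_lt
    (lintegral_add_const_rpow_ne_top (by linarith) hmom L).lt_top).ne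
  calc ∫⁻ y in Ioi (0 : ℝ),
        {p : ℝ × ℝ | p.1 ≤ p.2}.indicator (fun p => ENNReal.ofReal (p.1 + L) ^ χ) (y, z)
      ≤ ∫⁻ y in Ioi (0 : ℝ), (Iic z).indicator (fun _ => ENNReal.ofReal (z + L) ^ χ) y := by
        refine lintegral_mono fun y => ?_
        by_cases hy : y ≤ z
        · rw [indicator_of_mem (show (y, z) ∈ {p : ℝ × ℝ | p.1 ≤ p.2} from hy),
            indicator_of_mem (mem_Iic.2 hy)]
          exact ENNReal.rpow_le_rpow (ENNReal.ofReal_le_ofReal (by simpa using hy)) hχ.le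
        · rw [indicator_of_notMem (show (y, z) ∉ {p : ℝ × ℝ | p.1 ≤ p.2} from hy)]
          exact zero_le
    _ = ENNReal.ofReal (z + L) ^ χ * ENNReal.ofReal z := by
        rw [lintegral_indicator measurableSet_Iic, setLIntegral_const,
          Measure.restrict_apply measurableSet_Iic, inter_comm, Ioi_inter_Iic, Real.volume_Ioc,
          sub_zero]
    _ ≤ ENNReal.ofReal (z + L) ^ χ * ENNReal.ofReal (z + L) :=
        mul_le_mul_right (ENNReal.ofReal_le_ofReal (by linarith)) _
    _ = ENNReal.ofReal (z + L) ^ (1 + χ) := by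
        rw [ENNReal.rpow_add_of_nonneg _ _ zero_le_one hχ.le, ENNReal.rpow_one, mul_comm]

/-- A defective renewal inequality transfers tail moments from the step law to the solution. -/
lemma lintegral_rpow_mul_ne_top_of_renewal [IsProbabilityMeasure μ] (hpos : ∀ᵐ z ∂μ, 0 < z)
    (hχ : 0 < χ) (hmom : ∫⁻ z, ENNReal.ofReal z ^ (1 + χ) ∂μ ≠ ∞) (hK : K < 1)
    (hQ : Measurable Q) (hQ1 : ∀ y, Q y ≤ 1) (hQ0 : ∀ y ≤ 0, Q y = 0)
    (hren : ∀ y, 0 < y → Q y ≤ K * (∫⁻ z, Q (y - z) ∂μ) + μ (Ici y)) :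
    ∫⁻ y in Ioi (0 : ℝ), ENNReal.ofReal y ^ χ * Q y ≠ ∞ := by
  obtain ⟨L, hL, hKL⟩ := exists_mul_lintegral_rpow_lt_one hpos hχ hmom hK
  set K' := K * ∫⁻ z, ENNReal.ofReal (1 + z / L) ^ χ ∂μ
  set A := ∫⁻ y in Ioi (0 : ℝ), ENNReal.ofReal (y + L) ^ χ * μ (Ici y)
  have hA : A ≠ ∞ := lintegral_rpow_mul_measure_Ici_ne_top hχ hmom hL
  let W : ℝ → ℝ≥0∞ := fun y => ENNReal.ofReal (y + L) ^ χ
  have hW : Measurable W := by fun_prop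
  let I : ℝ → ℝ≥0∞ := fun R => ∫⁻ y in Ioi (0 : ℝ), (Iic R).indicator (fun y => W y * Q y) y
  have hstep : ∀ R z, 0 < z → ∫⁻ y in Ioi (0 : ℝ), (Iic R).indicator (fun y => W y * Q (y - z)) y ≤
      ENNReal.ofReal (1 + z / L) ^ χ * I R := by
    intro R z hz
    have hm : Measurable fun s => (Iic R).indicator (fun y => W y * Q y) s :=
      (hW.mul hQ).indicator measurableSet_Iic
    calc ∫⁻ y in Ioi (0 : ℝ), (Iic R).indicator (fun y => W y * Q (y - z)) y
        ≤ ∫⁻ y, (Ioi (0 : ℝ)).indicator (fun s => ENNReal.ofReal (1 + z / L) ^ χ *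
            (Iic R).indicator (fun y => W y * Q y) s) (y - z) := by
          refine (setLIntegral_le_lintegral _ _).trans (lintegral_mono fun y => ?_)
          by_cases hyR : y ∈ Iic R
          · rw [indicator_of_mem hyR]
            by_cases hyz : y - z ≤ 0
            · rw [hQ0 _ hyz, mul_zero]
              exact zero_le
            rw [not_le] at hyz
            rw [indicator_of_mem (mem_Ioi.2 hyz), indicator_of_mem
              (mem_Iic.2 (by linarith [mem_Iic.1 hyR])), ← mul_assoc,
              ← ENNReal.mul_rpow_of_nonneg _ _ hχ.le,
              ← ENNReal.ofReal_mul (by positivity)]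
            refine mul_le_mul_left (ENNReal.rpow_le_rpow (ENNReal.ofReal_le_ofReal ?_) hχ.le) _
            have : 0 ≤ z / L * (y - z) := by positivity
            have h2 : z / L * L = z := div_mul_cancel₀ _ hL.ne'
            nlinarith
          · rw [indicator_of_notMem hyR]
            exact zero_le
      _ = ENNReal.ofReal (1 + z / L) ^ χ * I R := by
          rw [lintegral_sub_right_eq_self (fun s => (Ioi (0 : ℝ)).indicator (fun s =>
            ENNReal.ofReal (1 + z / L) ^ χ * (Iic R).indicator (fun y => W y * Q y) s) s) z,
            lintegral_indicator measurableSet_Ioi, lintegral_const_mul _ hm]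
  have hineq : ∀ R, I R ≤ K' * I R + A := by
    intro R
    have hmeas : Measurable (Function.uncurry fun y z : ℝ =>
        (Iic R).indicator (fun y => W y * Q (y - z)) y) := by
      have : (Function.uncurry fun y z : ℝ => (Iic R).indicator (fun y => W y * Q (y - z)) y) =
          (Prod.fst ⁻¹' Iic R).indicator fun p : ℝ × ℝ => W p.1 * Q (p.1 - p.2) := by
        ext ⟨y, z⟩
        by_cases hy : y ≤ R
        · rw [indicator_of_mem (show (y, z) ∈ Prod.fst ⁻¹' Iic R from hy)]
          exact indicator_of_mem (f := fun y' => W y' * Q (y' - z)) (mem_Iic.2 hy)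
        · rw [indicator_of_notMem (show (y, z) ∉ Prod.fst ⁻¹' Iic R from hy)]
          exact indicator_of_notMem (f := fun y' => W y' * Q (y' - z)) (show y ∉ Iic R from hy)
      rw [this]
      exact ((hW.comp measurable_fst).mul
        (hQ.comp (measurable_fst.sub measurable_snd))).indicator
        (measurable_fst measurableSet_Iic)
    calc I R ≤ ∫⁻ y in Ioi (0 : ℝ), (K * (∫⁻ z, (Iic R).indicator (fun y => W y * Q (y - z)) y ∂μ)
          + W y * μ (Ici y)) := by
          refine setLIntegral_mono' measurableSet_Ioi fun y hy => ?_
          by_cases hyR : y ∈ Iic R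
          · simp only [indicator_of_mem hyR]
            rw [lintegral_const_mul _ (by fun_prop), mul_left_comm, ← mul_add]
            exact mul_le_mul_right (hren y hy) _
          · rw [indicator_of_notMem hyR]
            exact zero_le
      _ = K * (∫⁻ z, (∫⁻ y in Ioi (0 : ℝ), (Iic R).indicator (fun y => W y * Q (y - z)) y) ∂μ)
          + A := by
          rw [lintegral_add_left (by exact (hmeas.lintegral_prod_right').const_mul K),
            lintegral_const_mul _ (by exact hmeas.lintegral_prod_right'),
            lintegral_lintegral_swap hmeas.aemeasurable]
      _ ≤ K * (∫⁻ z, ENNReal.ofReal (1 + z / L) ^ χ * I R ∂μ) + A := by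
          refine add_le_add_left (mul_le_mul_right (lintegral_mono_ae ?_) _) _
          filter_upwards [hpos] with z hz using hstep R z hz
      _ = K' * I R + A := by
          rw [lintegral_mul_const _ (by fun_prop), mul_assoc]
  have hfin : ∀ R, I R ≠ ∞ := by
    intro R
    have : I R ≤
        ∫⁻ y in Ioi (0 : ℝ), (Iic R).indicator (fun _ => ENNReal.ofReal (R + L) ^ χ) y := by
      refine lintegral_mono fun y => indicator_le_indicator' fun hy => ?_
      refine (mul_le_mul' (ENNReal.rpow_le_rpow (ENNReal.ofReal_le_ofReal ?_) hχ.le)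
        (hQ1 y)).trans_eq (mul_one _)
      simpa using hy
    refine (this.trans_lt ?_).ne
    rw [lintegral_indicator measurableSet_Iic, setLIntegral_const,
      Measure.restrict_apply measurableSet_Iic, inter_comm, Ioi_inter_Iic, Real.volume_Ioc]
    exact ENNReal.mul_lt_top (ENNReal.rpow_lt_top_of_nonneg hχ.le ENNReal.ofReal_ne_top)
      ENNReal.ofReal_lt_top
  have hbound : ∀ R, I R ≤ A / (1 - K') := by
    intro R
    have h0 : 1 - K' ≠ 0 := (tsub_pos_of_lt hKL).ne'
    rw [ENNReal.le_div_iff_mul_le (Or.inl h0) (Or.inr hA), mul_comm,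
      ENNReal.sub_mul fun _ _ => hfin R, one_mul, tsub_le_iff_left]
    exact hineq R
  have hlim : Tendsto (fun n : ℕ => ∫⁻ y in Iic (n : ℝ), W y * Q y ∂(volume.restrict (Ioi 0)))
      atTop (𝓝 (∫⁻ y in Ioi (0 : ℝ), W y * Q y)) :=
    (aecover_Iic tendsto_natCast_atTop_atTop).lintegral_tendsto_of_countably_generated
      (hW.mul hQ).aemeasurable
  have hle : ∫⁻ y in Ioi (0 : ℝ), W y * Q y ≤ A / (1 - K') :=
    le_of_tendsto' hlim fun n => by
      rw [← lintegral_indicator measurableSet_Iic]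
      exact hbound n
  refine ((lintegral_mono fun y => ?_).trans_lt (hle.trans_lt
    (ENNReal.div_lt_top hA (tsub_pos_of_lt hKL).ne'))).ne
  exact mul_le_mul_left (ENNReal.rpow_le_rpow (ENNReal.ofReal_le_ofReal (by linarith)) hχ.le) _

end renewal

section moments

variable {J : Measure ℝ} {h φ : ℝ → ℝ}

lemma IsCDF.cdfMeasure_eq (hφ : IsCDF φ) :
    cdfMeasure φ = StieltjesFunction.measure ⟨φ, hφ.mono, hφ.right_continuous⟩ :=
  dif_pos ⟨hφ.mono, hφ.right_continuous⟩

lemma IsCDF.isProbabilityMeasure (hφ : IsCDF φ) : IsProbabilityMeasure (cdfMeasure φ) := by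
  rw [hφ.cdfMeasure_eq]
  exact StieltjesFunction.isProbabilityMeasure _ hφ.tendsto_atBot hφ.tendsto_atTop

lemma IsCDF.cdfMeasure_Iic (hφ : IsCDF φ) (x : ℝ) :
    cdfMeasure φ (Iic x) = ENNReal.ofReal (φ x) := by
  rw [hφ.cdfMeasure_eq, StieltjesFunction.measure_Iic _ hφ.tendsto_atBot, sub_zero]

lemma IsCDF.cdfMeasure_Ioi (hφ : IsCDF φ) (x : ℝ) :
    cdfMeasure φ (Ioi x) = ENNReal.ofReal (1 - φ x) := by
  rw [hφ.cdfMeasure_eq, StieltjesFunction.measure_Ioi _ hφ.tendsto_atTop]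

lemma IsCDF.cdfMeasure_comp_sub (hφ : IsCDF φ) (c : ℝ) :
    cdfMeasure (fun x => φ (x - c)) = (cdfMeasure φ).map (· + c) := by
  have := (hφ.comp_sub_const c).isProbabilityMeasure
  refine Measure.ext_of_Iic _ _ fun a => ?_
  rw [(hφ.comp_sub_const c).cdfMeasure_Iic, Measure.map_apply (measurable_add_const c)
    measurableSet_Iic]
  have : (· + c) ⁻¹' Iic a = Iic (a - c) := by
    ext x
    simp [le_sub_iff_add_le]
  rw [this, hφ.cdfMeasure_Iic]

lemma IsWave.comp_sub_const (hw : IsWave J h φ) (c : ℝ) : IsWave J h fun x => φ (x - c) := by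
  intro x
  beta_reduce
  rw [hw]
  simp only [sub_right_comm]

/-- Exponential decay of a wave at `-∞`. -/
lemma IsWave.exists_le_exp [IsProbabilityMeasure (excessLaw J)]
    (hh : IsConcaveRate h) (hφ : IsCDF φ) (hw : IsWave J h φ) (h0 : φ 0 = 1 / 2) :
    ∃ a C : ℝ, 0 < a ∧ ∀ x ≤ 0, φ x ≤ C * Real.exp (a * x) := by
  have hκ : 1 < 2 * h (1 / 2) := by
    linarith [hh.lt_apply (u := 1 / 2) ⟨by norm_num, by norm_num⟩]
  set κ := 2 * h (1 / 2)
  obtain ⟨b, hb0, hb⟩ : ∃ b : ℝ, 0 < b ∧ 1 < κ * (excessLaw J).real (Iic b) := by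
    have h1 : Tendsto (fun b => κ * (excessLaw J).real (Iic b)) atTop (𝓝 κ) := by
      have := (ENNReal.tendsto_toReal (measure_ne_top (excessLaw J) univ)).comp
        (tendsto_measure_Iic_atTop (excessLaw J))
      have := this.const_mul κ
      simpa [Function.comp_def, Measure.real] using this
    obtain ⟨b, hb, hb'⟩ := ((h1.eventually (lt_mem_nhds hκ)).and (eventually_gt_atTop 0)).exists
    exact ⟨b, hb', hb⟩
  set s := κ * (excessLaw J).real (Iic b)
  have hs0 : 0 < s := zero_lt_one.trans hb
  have hstep : ∀ x ≤ 0, s * φ (x - b) ≤ φ x := by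
    intro x hx
    have hint : Integrable (fun z => h (φ (x - z))) (excessLaw J) :=
      integrable_comp_sub hh.continuous (fun u hu => ⟨hh.nonneg hu.1, hh.le_one hu.2⟩)
        hφ.mono.measurable (fun x => ⟨hφ.nonneg x, hφ.le_one x⟩) x
    calc s * φ (x - b) = ∫ z, (Iic b).indicator (fun _ => κ * φ (x - b)) z ∂(excessLaw J) := by
          rw [integral_indicator_const _ measurableSet_Iic, smul_eq_mul]
          ring
      _ ≤ ∫ z, h (φ (x - z)) ∂(excessLaw J) := by
          refine integral_mono_ae ((integrable_const _).indicator measurableSet_Iic) hint ?_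
          filter_upwards [ae_excessLaw_pos] with z hz
          by_cases hzb : z ≤ b
          · rw [indicator_of_mem (mem_Iic.2 hzb)]
            have h1 := hh.mul_le (hφ.nonneg (x - b))
              (h0 ▸ hφ.mono (by linarith : x - b ≤ 0)) (by norm_num)
            have h2 := hh.monotone (hφ.mono (by linarith : x - b ≤ x - z))
            simp only [κ]
            linarith
          · rw [indicator_of_notMem (fun h => hzb (mem_Iic.1 h))]
            exact hh.nonneg (hφ.nonneg _)
      _ = φ x := (hw x).symm
  have hpow : ∀ n : ℕ, s ^ n * φ (-(n * b)) ≤ 1 := by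
    intro n
    induction n with
    | zero => simpa using hφ.le_one 0
    | succ n ih =>
      have := hstep (-(n * b)) (by have : (0 : ℝ) ≤ n := n.cast_nonneg; nlinarith)
      calc s ^ (n + 1) * φ (-((n + 1 : ℕ) * b)) = s ^ n * (s * φ (-(n * b) - b)) := by
            rw [pow_succ, mul_assoc]
            congr 3
            push_cast
            ring
        _ ≤ s ^ n * φ (-(n * b)) := mul_le_mul_of_nonneg_left this (by positivity)
        _ ≤ 1 := ih
  refine ⟨Real.log s / b, s, div_pos (Real.log_pos hb) hb0, fun x hx => ?_⟩
  have hn := Nat.floor_le (div_nonneg (neg_nonneg.2 hx) hb0.le)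
  have hn' := Nat.lt_floor_add_one (-x / b)
  set n := ⌊-x / b⌋₊
  have h1 : φ x ≤ φ (-(n * b)) := hφ.mono (by
    have := (le_div_iff₀ hb0).1 hn
    linarith)
  have h2 : s * Real.exp (Real.log s / b * x) * s ^ n ≥ 1 := by
    rw [← Real.exp_log (pow_pos hs0 n), Real.log_pow]
    nth_rewrite 1 [← Real.exp_log hs0]
    rw [← Real.exp_add, ← Real.exp_add, ge_iff_le, Real.one_le_exp_iff]
    have : 0 ≤ Real.log s * (n + 1 - -x / b) :=
      mul_nonneg (Real.log_pos hb).le (sub_nonneg.2 hn'.le)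
    calc 0 ≤ Real.log s * (n + 1 - -x / b) := this
      _ = _ := by ring
  calc φ x ≤ φ (-(n * b)) * 1 := by rw [mul_one]; exact h1
    _ ≤ φ (-(n * b)) * (s * Real.exp (Real.log s / b * x) * s ^ n) :=
        mul_le_mul_of_nonneg_left h2 (hφ.nonneg _)
    _ = s * Real.exp (Real.log s / b * x) * (s ^ n * φ (-(n * b))) := by ring
    _ ≤ s * Real.exp (Real.log s / b * x) := mul_le_of_le_one_right (by positivity) (hpow n)

lemma IsWave.lintegral_left_ne_top [IsProbabilityMeasure (excessLaw J)]
    (hh : IsConcaveRate h) (hφ : IsCDF φ) (hw : IsWave J h φ) (h0 : φ 0 = 1 / 2)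
    {χ : ℝ} (hχ : 0 < χ) :
    ∫⁻ t in Ioi (0 : ℝ), ENNReal.ofReal t ^ χ * ENNReal.ofReal (φ (-t)) ≠ ∞ := by
  obtain ⟨a, C, ha, hC⟩ := hw.exists_le_exp hh hφ h0
  have hint : IntegrableOn (fun t : ℝ => C * (t ^ χ * Real.exp (-a * t ^ (1 : ℝ)))) (Ioi 0) :=
    (integrableOn_rpow_mul_exp_neg_mul_rpow (by linarith) one_pos ha).const_mul C
  refine ((setLIntegral_mono' measurableSet_Ioi fun t ht => ?_).trans_lt
    hint.lintegral_lt_top).ne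
  have ht0 : (0 : ℝ) < t := ht
  rw [ENNReal.ofReal_rpow_of_pos ht0, ← ENNReal.ofReal_mul (by positivity)]
  refine ENNReal.ofReal_le_ofReal ?_
  have := mul_le_mul_of_nonneg_left (hC (-t) (by linarith)) (Real.rpow_nonneg ht0.le χ)
  rw [Real.rpow_one]
  calc _ ≤ _ := this
    _ = _ := by ring_nf

lemma IsConcaveRate.one_sub_le (hh : IsConcaveRate h) {u : ℝ} (hu : 1 / 2 ≤ u) (hu1 : u ≤ 1) :
    1 - h u ≤ 2 * (1 - h (1 / 2)) * (1 - u) := by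
  have hc := hh.strictConcaveOn.concaveOn.2
    (⟨by norm_num, by norm_num⟩ : (1 / 2 : ℝ) ∈ Icc (0 : ℝ) 1) (right_mem_Icc.2 zero_le_one)
    (by linarith : 0 ≤ 2 * (1 - u)) (by linarith : 0 ≤ 2 * u - 1) (by ring)
  simp only [smul_eq_mul, hh.one] at hc
  rw [show 2 * (1 - u) * (1 / 2) + (2 * u - 1) * 1 = u by ring] at hc
  linarith

lemma IsWave.lintegral_right_ne_top [IsProbabilityMeasure (excessLaw J)]
    (hh : IsConcaveRate h) (hφ : IsCDF φ) (hw : IsWave J h φ) (h0 : φ 0 = 1 / 2)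
    {χ : ℝ} (hχ : 0 < χ) (hmom : ∫⁻ z, ENNReal.ofReal z ^ (1 + χ) ∂(excessLaw J) ≠ ∞) :
    ∫⁻ t in Ioi (0 : ℝ), ENNReal.ofReal t ^ χ * ENNReal.ofReal (1 - φ t) ≠ ∞ := by
  have hκ : 2 * (1 - h (1 / 2)) < 1 := by
    linarith [hh.lt_apply (u := 1 / 2) ⟨by norm_num, by norm_num⟩]
  have hκ0 : 0 ≤ 2 * (1 - h (1 / 2)) := by
    linarith [hh.le_one (u := 1 / 2) (by norm_num)]
  set κ := 2 * (1 - h (1 / 2))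
  let Q : ℝ → ℝ≥0∞ := (Ioi 0).indicator fun t => ENNReal.ofReal (1 - φ t)
  have hφmeas : Measurable φ := hφ.mono.measurable
  have hQ : Measurable Q := (by fun_prop : Measurable fun t => ENNReal.ofReal (1 - φ t)).indicator
    measurableSet_Ioi
  have hmain := lintegral_rpow_mul_ne_top_of_renewal (μ := excessLaw J) (Q := Q)
    (K := ENNReal.ofReal κ) ae_excessLaw_pos hχ hmom (by simpa using hκ) hQ
    (fun y => ?_) (fun y hy => indicator_of_notMem (by simpa using hy) _) fun y hy => ?_
  · rwa [setLIntegral_congr_fun (g := fun y => ENNReal.ofReal y ^ χ * Q y) measurableSet_Ioi]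
    intro t ht
    simp only [Q, indicator_of_mem ht]
  · refine indicator_le' (g := fun _ => 1) (fun _ _ => ?_) (fun _ _ => zero_le) y
    rw [ENNReal.ofReal_le_one]
    exact sub_le_self _ (hφ.nonneg _)
  · have hrange : ∀ u ∈ Icc (0 : ℝ) 1, h u ∈ Icc (0 : ℝ) 1 := fun u hu =>
      ⟨hh.nonneg hu.1, hh.le_one hu.2⟩
    have hint : Integrable (fun z => h (φ (y - z))) (excessLaw J) :=
      integrable_comp_sub hh.continuous hrange hφmeas (fun x => ⟨hφ.nonneg x, hφ.le_one x⟩) y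
    have heq : 1 - φ y = ∫ z, (1 - h (φ (y - z))) ∂(excessLaw J) := by
      rw [integral_sub (integrable_const _) hint, ← hw y]
      simp
    calc Q y = ∫⁻ z, ENNReal.ofReal (1 - h (φ (y - z))) ∂(excessLaw J) := by
          simp only [Q]
          rw [indicator_of_mem (mem_Ioi.2 hy), heq, ofReal_integral_eq_lintegral_ofReal
            (f := fun z => 1 - h (φ (y - z))) ((integrable_const _).sub hint)]
          exact Eventually.of_forall fun z => sub_nonneg.2 (hh.le_one (hφ.le_one _))
      _ ≤ ∫⁻ z, (ENNReal.ofReal κ * Q (y - z) + (Ici y).indicator 1 z) ∂(excessLaw J) := by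
          refine lintegral_mono fun z => ?_
          by_cases hz : z < y
          · refine le_add_right ?_
            simp only [Q]
            rw [indicator_of_mem (mem_Ioi.2 (sub_pos.2 hz)), ← ENNReal.ofReal_mul hκ0]
            refine ENNReal.ofReal_le_ofReal (hh.one_sub_le ?_ (hφ.le_one _))
            rw [← h0]
            exact hφ.mono (sub_pos.2 hz).le
          · refine le_add_left ?_
            rw [indicator_of_mem (mem_Ici.2 (not_lt.1 hz)), Pi.one_apply, ENNReal.ofReal_le_one]
            linarith [hh.nonneg (hφ.nonneg (y - z))]
      _ = _ := by
          rw [lintegral_add_left (by fun_prop), lintegral_const_mul _ (by fun_prop),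
            lintegral_indicator_one measurableSet_Ici]

lemma lintegral_rpow_excessLaw_ne_top [SFinite J] {χ : ℝ} (hχ : 0 < χ)
    (hJ0 : J (Iic 0) = 0) (hJmom : Integrable (fun z => |z| ^ (2 + χ)) J) :
    ∫⁻ z, ENNReal.ofReal z ^ (1 + χ) ∂(excessLaw J) ≠ ∞ := by
  rw [lintegral_excessLaw (by fun_prop)]
  refine (lt_of_le_of_lt (lintegral_mono_ae ?_) hJmom.lintegral_lt_top).ne
  have : ∀ᵐ z ∂J, z ∉ Iic (0 : ℝ) := measure_eq_zero_iff_ae_notMem.1 hJ0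
  filter_upwards [this] with u hu
  have hu : 0 < u := not_le.1 hu
  calc ∫⁻ z in Ioo 0 u, ENNReal.ofReal z ^ (1 + χ)
      ≤ ∫⁻ z in Ioo 0 u, ENNReal.ofReal u ^ (1 + χ) := setLIntegral_mono' measurableSet_Ioo
        fun z hz => ENNReal.rpow_le_rpow (ENNReal.ofReal_le_ofReal hz.2.le) (by linarith)
    _ = ENNReal.ofReal (|u| ^ (2 + χ)) := by
        rw [setLIntegral_const, Real.volume_Ioo, sub_zero, abs_of_pos hu,
          ENNReal.ofReal_rpow_of_pos hu, ← ENNReal.ofReal_mul (by positivity)]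
        congr 1
        rw [show 2 + χ = (1 + χ) + 1 by ring, Real.rpow_add_one hu.ne']

/-- Waves inherit the moments of the excess law. -/
lemma IsWave.memLp [IsProbabilityMeasure (excessLaw J)]
    (hh : IsConcaveRate h) (hφ : IsCDF φ) (hw : IsWave J h φ) (h0 : φ 0 = 1 / 2)
    {χ : ℝ} (hχ : 0 < χ) (hmom : ∫⁻ z, ENNReal.ofReal z ^ (1 + χ) ∂(excessLaw J) ≠ ∞) :
    MemLp (fun x : ℝ => x) (ENNReal.ofReal (1 + χ)) (cdfMeasure φ) := by
  have hp : (ENNReal.ofReal (1 + χ)).toReal = 1 + χ := ENNReal.toReal_ofReal (by linarith)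
  refine (integrable_norm_rpow_iff (f := fun x : ℝ => x) aestronglyMeasurable_id (by simp; linarith)
    ENNReal.ofReal_ne_top).1 ?_
  rw [hp]
  refine ⟨(by fun_prop : Measurable fun x : ℝ => ‖x‖ ^ (1 + χ)).aestronglyMeasurable, ?_⟩
  rw [hasFiniteIntegral_iff_ofReal (Eventually.of_forall fun x => by positivity)]
  simp only [Real.norm_eq_abs]
  rw [lintegral_rpow_eq_lintegral_meas_lt_mul (cdfMeasure φ)
    (Eventually.of_forall fun x => abs_nonneg x) (by fun_prop) (by linarith : 0 < 1 + χ)]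
  refine ENNReal.mul_lt_top ENNReal.ofReal_lt_top (lt_of_le_of_lt (setLIntegral_mono'
    (g := fun t => ENNReal.ofReal t ^ χ * ENNReal.ofReal (1 - φ t) +
      ENNReal.ofReal t ^ χ * ENNReal.ofReal (φ (-t))) measurableSet_Ioi fun t ht => ?_) ?_)
  · have ht : (0 : ℝ) < t := ht
    rw [add_sub_cancel_left, ← mul_add, ENNReal.ofReal_rpow_of_pos ht, mul_comm]
    refine mul_le_mul_right ?_ _
    rw [← hφ.cdfMeasure_Ioi, ← hφ.cdfMeasure_Iic]
    refine (measure_mono fun x hx => ?_).trans (measure_union_le _ _)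
    rcases lt_abs.1 (show t < |x| from hx) with hx | hx
    · exact Or.inl hx
    · exact Or.inr (mem_Iic.2 (by linarith))
  · have hφmeas : Measurable φ := hφ.mono.measurable
    rw [lintegral_add_left (by fun_prop)]
    exact ENNReal.add_lt_top.2 ⟨(hw.lintegral_right_ne_top hh hφ h0 hχ hmom).lt_top,
      (hw.lintegral_left_ne_top hh hφ h0 hχ).lt_top⟩

end moments

section uniqueness

variable {φ ψ : ℝ → ℝ}

lemma IsCDF.lintegral_pos (hφ : IsCDF φ) :
    ∫⁻ x, ENNReal.ofReal x ∂(cdfMeasure φ) = ∫⁻ t in Ioi (0 : ℝ), ENNReal.ofReal (1 - φ t) := by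
  have := lintegral_eq_lintegral_meas_lt (cdfMeasure φ) (f := fun x => max x 0)
    (Eventually.of_forall fun x => le_max_right _ _) (by fun_prop)
  simp only [ENNReal.ofReal_max, ENNReal.ofReal_zero, max_zero] at this
  rw [this]
  refine setLIntegral_congr_fun measurableSet_Ioi fun t ht => ?_
  rw [← hφ.cdfMeasure_Ioi]
  congr 1
  ext x
  simp [not_lt.2 (mem_Ioi.1 ht).le]

lemma IsCDF.lintegral_neg (hφ : IsCDF φ) :
    ∫⁻ x, ENNReal.ofReal (-x) ∂(cdfMeasure φ) = ∫⁻ t in Ioi (0 : ℝ), ENNReal.ofReal (φ (-t)) := by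
  have := lintegral_eq_lintegral_meas_le (cdfMeasure φ) (f := fun x => max (-x) 0)
    (Eventually.of_forall fun x => le_max_right _ _) (by fun_prop)
  simp only [ENNReal.ofReal_max, ENNReal.ofReal_zero, max_zero] at this
  rw [this]
  refine setLIntegral_congr_fun measurableSet_Ioi fun t ht => ?_
  rw [← hφ.cdfMeasure_Iic]
  congr 1
  ext x
  simp [not_le.2 (mem_Ioi.1 ht), le_neg]

/-- Ordered continuous CDFs with the same mean coincide. -/
lemma IsCDF.eq_of_le_of_integral_eq (hφ : IsCDF φ) (hψ : IsCDF ψ) (hcφ : Continuous φ)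
    (hcψ : Continuous ψ) (hle : ∀ x, φ x ≤ ψ x)
    (hiφ : Integrable (fun x : ℝ => x) (cdfMeasure φ))
    (hiψ : Integrable (fun x : ℝ => x) (cdfMeasure ψ))
    (hmean : ∫ x, x ∂(cdfMeasure φ) = ∫ x, x ∂(cdfMeasure ψ)) : φ = ψ := by
  have hP := hiφ.lintegral_lt_top
  have hN := hiφ.neg.lintegral_lt_top
  have hP' := hiψ.lintegral_lt_top
  have hN' := hiψ.neg.lintegral_lt_top
  rw [integral_eq_lintegral_pos_part_sub_lintegral_neg_part hiφ,
    integral_eq_lintegral_pos_part_sub_lintegral_neg_part hiψ] at hmean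
  simp only [Pi.neg_apply] at hN hN'
  rw [hφ.lintegral_pos, hφ.lintegral_neg, hψ.lintegral_pos, hψ.lintegral_neg] at hmean
  rw [hφ.lintegral_pos] at hP
  rw [hψ.lintegral_pos] at hP'
  rw [hφ.lintegral_neg] at hN
  rw [hψ.lintegral_neg] at hN'
  have h1 : ∫⁻ t in Ioi (0 : ℝ), ENNReal.ofReal (1 - φ t) =
      (∫⁻ t in Ioi (0 : ℝ), ENNReal.ofReal (1 - ψ t)) +
        ∫⁻ t in Ioi (0 : ℝ), ENNReal.ofReal (ψ t - φ t) := by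
    rw [← lintegral_add_left (by fun_prop)]
    refine lintegral_congr fun t => ?_
    rw [← ENNReal.ofReal_add (sub_nonneg.2 (hψ.le_one t)) (sub_nonneg.2 (hle t))]
    ring_nf
  have h2 : ∫⁻ t in Ioi (0 : ℝ), ENNReal.ofReal (ψ (-t)) =
      (∫⁻ t in Ioi (0 : ℝ), ENNReal.ofReal (φ (-t))) +
        ∫⁻ t in Ioi (0 : ℝ), ENNReal.ofReal (ψ (-t) - φ (-t)) := by
    rw [← lintegral_add_left (by fun_prop)]
    refine lintegral_congr fun t => ?_
    rw [← ENNReal.ofReal_add (hφ.nonneg _) (sub_nonneg.2 (hle _))]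
    ring_nf
  set A := ∫⁻ t in Ioi (0 : ℝ), ENNReal.ofReal (ψ t - φ t) with hA
  set B := ∫⁻ t in Ioi (0 : ℝ), ENNReal.ofReal (ψ (-t) - φ (-t)) with hB
  have hAfin : A ≠ ∞ := fun h => hP.ne (by rw [h1, h, add_top])
  have hBfin : B ≠ ∞ := fun h => hN'.ne (by rw [h2, h, add_top])
  rw [h1, h2, ENNReal.toReal_add hP'.ne hAfin, ENNReal.toReal_add hN.ne hBfin] at hmean
  have hA0 : A = 0 := by
    have : A.toReal = 0 := by
      linarith [A.toReal_nonneg, B.toReal_nonneg]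
    exact ((ENNReal.toReal_eq_zero_iff _).1 this).resolve_right hAfin
  have hB0 : B = 0 := by
    have : B.toReal = 0 := by
      linarith [A.toReal_nonneg, B.toReal_nonneg]
    exact ((ENNReal.toReal_eq_zero_iff _).1 this).resolve_right hBfin
  have key : ∀ D : ℝ → ℝ, Continuous D → (∀ x, 0 ≤ D x) →
      ∫⁻ t in Ioi (0 : ℝ), ENNReal.ofReal (D t) = 0 → ∀ t, 0 ≤ t → D t = 0 := by
    intro D hD hD0 hint t ht
    rw [lintegral_eq_zero_iff (by fun_prop)] at hint
    have hae : D =ᵐ[volume.restrict (Ioi 0)] fun _ => 0 := by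
      filter_upwards [hint] with x hx
      exact le_antisymm (ENNReal.ofReal_eq_zero.1 hx) (hD0 x)
    have := (Measure.eqOn_open_of_ae_eq hae isOpen_Ioi hD.continuousOn
      continuousOn_const).closure hD continuous_const
    rw [closure_Ioi] at this
    exact this ht
  funext x
  rcases le_total 0 x with hx | hx
  · have := key (fun t => ψ t - φ t) (by fun_prop) (fun t => sub_nonneg.2 (hle t)) hA0 x hx
    linarith
  · have := key (fun t => ψ (-t) - φ (-t)) (by fun_prop) (fun t => sub_nonneg.2 (hle _)) hB0 (-x)
      (by linarith)
    simp only [neg_neg] at this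
    linarith

end uniqueness

lemma DensityLowerBdd.measure_Ioi_pos {J : Measure ℝ} (hJ : DensityLowerBdd J) (a : ℝ) :
    0 < J (Ioi a) := by
  obtain ⟨g, rfl, hg⟩ := hJ
  have hb : (0 : ℝ) < max a 0 + 1 := by linarith [le_max_right a 0]
  obtain ⟨c, hc, hcg⟩ := hg _ hb
  have hsub : Ioc (max a 0) (max a 0 + 1) ⊆ Ioi a := fun x hx =>
    (le_max_left a 0).trans_lt hx.1
  refine lt_of_lt_of_le ?_ (measure_mono hsub)
  rw [withDensity_apply _ measurableSet_Ioc]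
  calc 0 < c := hc
    _ = ∫⁻ _ in Ioc (max a 0) (max a 0 + 1), c := by simp
    _ ≤ _ := setLIntegral_mono' measurableSet_Ioc fun x hx =>
      hcg x ⟨(le_max_right a 0).trans hx.1.le, hx.2⟩

section Theorems
open MeasureTheory Filter Set ENNReal NNReal

theorem exists_unique_traveling_wave_shape
    (χ : ℝ) (hχ : 0 < χ)
    (η : ℝ → ℝ)
    (hη_cont : ContinuousOn η (Set.Icc 0 1))
    (hη_anti : StrictAntiOn η (Set.Icc 0 1))
    (hη0 : η 0 = 1) (hη1 : η 1 = 0)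
    (J : Measure ℝ) [IsProbabilityMeasure J]
    (hJ0 : J (Set.Iic 0) = 0)
    (hJmean : ∫ z, z ∂J = 1)
    (hJmom : Integrable (fun z => |z| ^ (2 + χ)) J)
    (hJdens : DensityLowerBdd J) :
    ∃ φ : ℝ → ℝ,
      (IsCDF φ ∧ Integrable (fun x => x) (cdfMeasure φ) ∧ (∫ x, x ∂(cdfMeasure φ)) = 0 ∧
        IsMFM η J (fun x t => φ (x - (∫ ν in Set.Ioo (0:ℝ) 1, η ν) * t))) ∧
      Integrable (fun y => |y| ^ (1 + χ)) (cdfMeasure φ) ∧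
      ∀ ψ : ℝ → ℝ,
        (IsCDF ψ ∧ Integrable (fun x => x) (cdfMeasure ψ) ∧ (∫ x, x ∂(cdfMeasure ψ)) = 0 ∧
          IsMFM η J (fun x t => ψ (x - (∫ ν in Set.Ioo (0:ℝ) 1, η ν) * t))) → ψ = φ := by
  rw [← cumRate_one]
  have hJ : Integrable (fun z : ℝ => z) J := by
    by_contra hcon
    rw [integral_undef hcon] at hJmean
    exact zero_ne_one hJmean
  have : IsProbabilityMeasure (excessLaw J) := ⟨excessLaw_univ hJmean hJ0⟩
  have hh := isConcaveRate_normRate hη_cont hη_anti hη0 hη1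
  obtain ⟨φ₀, hφ₀, hw₀, hhalf⟩ := exists_isWave hJ hJ0 hh
  have := hφ₀.isProbabilityMeasure
  have hLp₀ := hw₀.memLp hh hφ₀ hhalf hχ (lintegral_rpow_excessLaw_ne_top hχ hJ0 hJmom)
  have hp : (1 : ℝ≥0∞) ≤ ENNReal.ofReal (1 + χ) := by
    rw [ENNReal.one_le_ofReal]
    linarith
  have hint₀ : Integrable (fun x : ℝ => x) (cdfMeasure φ₀) := hLp₀.integrable hp
  set m := ∫ x, x ∂(cdfMeasure φ₀) with hm
  have hφ : IsCDF fun x => φ₀ (x - -m) := hφ₀.comp_sub_const (-m)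
  have hw := hw₀.comp_sub_const (-m)
  have hmap := hφ₀.cdfMeasure_comp_sub (-m)
  have hemb : MeasurableEmbedding fun x : ℝ => x + -m := measurableEmbedding_addRight (-m)
  have hint : Integrable (fun x : ℝ => x) (cdfMeasure fun x => φ₀ (x - -m)) := by
    rw [hmap, hemb.integrable_map_iff]
    exact hint₀.add (integrable_const _)
  have hmean : ∫ x, x ∂(cdfMeasure fun x => φ₀ (x - -m)) = 0 := by
    rw [hmap, hemb.integral_map, integral_add hint₀ (integrable_const _), ← hm]
    simp
  refine ⟨fun x => φ₀ (x - -m), ⟨hφ, hint, hmean,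
    isMFM_of_isWave hJ hJ0 hη_cont hη_anti hη0 hη1 hφ hw⟩, ?_, ?_⟩
  · rw [hmap, hemb.integrable_map_iff]
    have hLp := hLp₀.add (memLp_const (-m))
    have := hLp.integrable_norm_rpow (zero_lt_one.trans_le hp).ne' ENNReal.ofReal_ne_top
    rw [ENNReal.toReal_ofReal (by linarith)] at this
    exact this
  · rintro ψ ⟨hψ, hintψ, hmeanψ, hmfm⟩
    have hwψ := isWave_of_isMFM hJ hJ0 hη_cont hη_anti hη0 hη1 hψ hmfm
    have hcφ := (hw.lipschitz hJ hJ0 hh hφ).continuous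
    have hcψ := (hwψ.lipschitz hJ hJ0 hh hψ).continuous
    rcases hw.le_or_le hJ hJ0 hJdens.measure_Ioi_pos hh hφ hψ hwψ with hle | hle
    · exact (hφ.eq_of_le_of_integral_eq hψ hcφ hcψ hle hint hintψ (hmean.trans hmeanψ.symm)).symm
    · exact hψ.eq_of_le_of_integral_eq hφ hcψ hcφ hle hintψ hint (hmeanψ.trans hmean.symm)

end Theorems
end

section
/- Let χ > 0 and suppose ∫ z^{2+χ} dJ(z) < ∞ and J is absolutely continuous with a density bounded away from 0 on every compact subset of [0,∞). Then there exist a constant C̄ > 0 and n̄ ∈ ℕ such that for every n ≥ n̄ and every K_n-invariant Borel probability measure π on W_n, ∫_{W_n} (1/n) Σ_{i=1}^n |w_i|^{1+χ} dπ(w) ≤ C̄; that is, the (1+χ)-th absolute moment of the centered empirical distribution in the stationary regime is bounded uniformly in n. -/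
open MeasureTheory Filter Set ENNReal NNReal

/-- The odd power function has the expected derivative, also at the origin. -/
lemma hasDerivAt_abs_rpow_mul_self {χ : ℝ} (hχ : 0 < χ) (x : ℝ) :
    HasDerivAt (fun t : ℝ => |t| ^ χ * t) ((1 + χ) * |x| ^ χ) x := by
  rcases lt_trichotomy x 0 with hx | rfl | hx
  · have h1 : HasDerivAt (fun t : ℝ => (-t) ^ χ * t)
        ((-1) * χ * (-x) ^ (χ - 1) * x + (-x) ^ χ * 1) x :=
      ((hasDerivAt_id x).neg.rpow_const (Or.inl (by simpa using hx.ne))).mul (hasDerivAt_id x)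
    have h2 : (fun t : ℝ => |t| ^ χ * t) =ᶠ[nhds x] fun t => (-t) ^ χ * t := by
      filter_upwards [Iio_mem_nhds hx] with t ht
      rw [abs_of_neg ht]
    refine (h1.congr_of_eventuallyEq h2).congr_deriv ?_
    rw [abs_of_neg hx, Real.rpow_sub_one (by linarith)]
    have := hx.ne
    field_simp
    ring
  · rw [hasDerivAt_iff_tendsto_slope]
    have h1 : Tendsto (fun t : ℝ => |t| ^ χ) (nhdsWithin 0 {0}ᶜ) (nhds ((1 + χ) * |0| ^ χ)) := by
      have hc : Continuous fun t : ℝ => |t| ^ χ :=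
        continuous_abs.rpow_const fun _ => Or.inr hχ.le
      have := hc.tendsto 0
      simp only [abs_zero, Real.zero_rpow hχ.ne', mul_zero] at this ⊢
      exact this.mono_left nhdsWithin_le_nhds
    refine h1.congr' ?_
    filter_upwards [self_mem_nhdsWithin] with t ht
    have ht : t ≠ 0 := ht
    simp [slope_def_field, ht]
  · have h1 : HasDerivAt (fun t : ℝ => t ^ χ * t)
        (1 * χ * x ^ (χ - 1) * x + x ^ χ * 1) x :=
      ((hasDerivAt_id x).rpow_const (Or.inl hx.ne')).mul (hasDerivAt_id x)
    have h2 : (fun t : ℝ => |t| ^ χ * t) =ᶠ[nhds x] fun t => t ^ χ * t := by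
      filter_upwards [Ioi_mem_nhds hx] with t ht
      rw [abs_of_pos ht]
    refine (h1.congr_of_eventuallyEq h2).congr_deriv ?_
    rw [abs_of_pos hx, Real.rpow_sub_one hx.ne']
    field_simp
    ring

lemma abs_add_rpow_le {a b χ : ℝ} (ha : 0 ≤ a) (hb : 0 ≤ b) (hχ : 0 < χ) :
    (a + b) ^ χ ≤ 2 ^ χ * (a ^ χ + b ^ χ) := by
  have h1 : (a + b) ^ χ ≤ (2 * max a b) ^ χ :=
    Real.rpow_le_rpow (by positivity)
      (by linarith [le_max_left a b, le_max_right a b]) hχ.le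
  rw [Real.mul_rpow (by norm_num) (by positivity)] at h1
  refine h1.trans (mul_le_mul_of_nonneg_left ?_ (by positivity))
  have := Real.rpow_nonneg ha χ
  have := Real.rpow_nonneg hb χ
  rcases max_choice a b with h | h <;> rw [h] <;> linarith

/-- Second-order Taylor bound for `|x|^(2+χ)`. -/
lemma abs_add_rpow_taylor {χ : ℝ} (hχ : 0 < χ) (x y : ℝ) :
    |x + y| ^ (2 + χ) ≤ |x| ^ (2 + χ) + (2 + χ) * (|x| ^ χ * x) * y
      + (2 + χ) * (1 + χ) * 2 ^ χ * (|x| ^ χ * y ^ 2 + |y| ^ (2 + χ)) := by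
  set R := |x| + |y|
  have hR : 0 ≤ R := by positivity
  have hlip : ∀ u ∈ Metric.closedBall x |y|,
      ‖|u| ^ χ * u - |x| ^ χ * x‖ ≤ (1 + χ) * R ^ χ * ‖u - x‖ := by
    intro u hu
    refine Convex.norm_image_sub_le_of_norm_hasDerivWithin_le
      (f := fun t : ℝ => |t| ^ χ * t) (f' := fun t => (1 + χ) * |t| ^ χ)
      (fun t _ => (hasDerivAt_abs_rpow_mul_self hχ t).hasDerivWithinAt)
      (fun t ht => ?_) (convex_closedBall x |y|) (Metric.mem_closedBall_self (abs_nonneg y)) hu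
    rw [Real.norm_of_nonneg (by positivity)]
    rw [Metric.mem_closedBall, Real.dist_eq] at ht
    gcongr
    have := abs_sub_abs_le_abs_sub t x
    simp only [R]
    linarith
  have hmain := Convex.norm_image_sub_le_of_norm_hasDerivWithin_le
      (f := fun t : ℝ => |t| ^ (2 + χ) - (2 + χ) * (|x| ^ χ * x) * t)
      (f' := fun t => (2 + χ) * |t| ^ (2 + χ - 2) * t - (2 + χ) * (|x| ^ χ * x) * 1)
      (C := (2 + χ) * ((1 + χ) * R ^ χ * |y|)) (s := Metric.closedBall x |y|) (x := x) (y := x + y)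
      (fun t _ => ((hasDerivAt_abs_rpow t (by linarith)).sub
        ((hasDerivAt_id t).const_mul _)).hasDerivWithinAt)
      (fun t ht => ?_) (convex_closedBall x |y|) (Metric.mem_closedBall_self (abs_nonneg y))
      (by simp)
  · have h1 := (le_abs_self _).trans hmain
    have h2 : R ^ χ * y ^ 2 ≤ 2 ^ χ * (|x| ^ χ * y ^ 2 + |y| ^ (2 + χ)) := by
      have h3 : |y| ^ (2 + χ) = |y| ^ χ * y ^ 2 := by
        rw [add_comm, Real.rpow_add_of_nonneg (abs_nonneg y) hχ.le (by norm_num)]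
        norm_num
      rw [h3, ← add_mul, ← mul_assoc]
      exact mul_le_mul_of_nonneg_right
        (abs_add_rpow_le (abs_nonneg x) (abs_nonneg y) hχ) (sq_nonneg y)
    have h4 : (2 + χ) * ((1 + χ) * R ^ χ * |y|) * ‖x + y - x‖
        = (2 + χ) * (1 + χ) * (R ^ χ * y ^ 2) := by
      rw [add_sub_cancel_left, Real.norm_eq_abs, ← sq_abs y]
      ring
    rw [h4] at h1
    have h5 := mul_le_mul_of_nonneg_left h2 (by positivity : 0 ≤ (2 + χ) * (1 + χ))
    linarith
  · have h1 := hlip t ht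
    have h2 : (2 + χ) * |t| ^ (2 + χ - 2) * t - (2 + χ) * (|x| ^ χ * x) * 1
        = (2 + χ) * (|t| ^ χ * t - |x| ^ χ * x) := by
      rw [show 2 + χ - 2 = χ by ring]
      ring
    rw [h2, norm_mul, Real.norm_of_nonneg (by positivity : 0 ≤ 2 + χ)]
    rw [Metric.mem_closedBall, Real.dist_eq] at ht
    refine mul_le_mul_of_nonneg_left (h1.trans ?_) (by positivity)
    exact mul_le_mul_of_nonneg_left ht (by positivity)

/-- The increment of the odd power below a level `b ≥ 0` dominates its linearization there. -/
lemma rpow_mul_sub_le {χ b : ℝ} (hχ : 0 < χ) (hb : 0 ≤ b) (x : ℝ) :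
    b ^ χ * (b - x) ≤ 2 * |(|x| ^ χ * x) - b ^ χ * b| := by
  have hbχ : 0 ≤ b ^ χ := Real.rpow_nonneg hb χ
  rcases le_total b x with h | h
  · exact (mul_nonpos_of_nonneg_of_nonpos hbχ (by linarith)).trans (by positivity)
  rw [abs_sub_comm]
  refine le_trans ?_ (mul_le_mul_of_nonneg_left (le_abs_self _) (by norm_num))
  rcases le_total 0 x with h0 | h0
  · rw [abs_of_nonneg h0]
    have := Real.rpow_le_rpow h0 h hχ.le
    nlinarith
  · rw [abs_of_nonpos h0]
    rcases le_total (-x) b with h1 | h1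
    · have := Real.rpow_nonneg (neg_nonneg.2 h0) χ
      nlinarith
    · have := Real.rpow_le_rpow hb h1 hχ.le
      nlinarith

lemma card_mul_le_sum_abs_sub {ι : Type*} [Fintype ι] {χ H : ℝ} (hχ : 0 < χ) (hH : 0 ≤ H)
    (w : ι → ℝ) (hw : ∑ i, w i = 0) :
    Fintype.card ι * H ≤ 2 * ∑ i, |(|w i| ^ χ * w i) - H| := by
  set b := H ^ (1 / (1 + χ))
  have hb : 0 ≤ b := Real.rpow_nonneg hH _
  have hbH : b ^ χ * b = H := by
    nth_rewrite 2 [← Real.rpow_one b]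
    rw [← Real.rpow_add_of_nonneg hb hχ.le zero_le_one, ← Real.rpow_mul hH]
    rw [add_comm χ 1, one_div_mul_cancel (by positivity), Real.rpow_one]
  have h := Finset.sum_le_sum fun i (_ : i ∈ Finset.univ) => rpow_mul_sub_le hχ hb (w i)
  rw [← Finset.mul_sum, ← Finset.mul_sum, Finset.sum_sub_distrib, hw, hbH] at h
  calc (Fintype.card ι : ℝ) * H = b ^ χ * (∑ _i : ι, b - 0) := by
        simp [← hbH]; ring
    _ ≤ _ := h

/-- For centred families, the absolute moment is controlled by the oscillation of the odd power. -/
lemma sum_abs_le_sum_abs_sub {ι : Type*} [Fintype ι] {χ : ℝ} (hχ : 0 < χ) (H : ℝ)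
    (w : ι → ℝ) (hw : ∑ i, w i = 0) :
    ∑ i, |(|w i| ^ χ * w i)| ≤ 3 * ∑ i, |(|w i| ^ χ * w i) - H| := by
  have key : Fintype.card ι * |H| ≤ 2 * ∑ i, |(|w i| ^ χ * w i) - H| := by
    rcases le_total 0 H with hH | hH
    · rw [abs_of_nonneg hH]
      exact card_mul_le_sum_abs_sub hχ hH w hw
    · rw [abs_of_nonpos hH]
      convert card_mul_le_sum_abs_sub hχ (neg_nonneg.2 hH) (fun i => -w i) (by simp [hw])
        using 3 with i
      rw [abs_neg (w i), mul_neg, ← abs_neg]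
      congr 1
      ring
  have h : ∑ i, |(|w i| ^ χ * w i)| ≤ ∑ i, (|(|w i| ^ χ * w i) - H| + |H|) :=
    Finset.sum_le_sum fun i _ => by
      have := abs_add_le ((|w i| ^ χ * w i) - H) H
      rwa [sub_add_cancel] at this
  rw [Finset.sum_add_distrib, Finset.sum_const, Finset.card_univ, nsmul_eq_mul] at h
  linarith

lemma rpow_le_mul_rpow_add {χ ε x : ℝ} (hχ : 0 < χ) (hε : 0 < ε) (hx : 0 ≤ x) :
    x ^ χ ≤ ε * x ^ (1 + χ) + (1 / ε) ^ χ := by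
  rcases le_total x (1 / ε) with h | h
  · have := Real.rpow_le_rpow hx h hχ.le
    have : 0 ≤ ε * x ^ (1 + χ) := by positivity
    linarith
  · rw [Real.rpow_add_of_nonneg hx zero_le_one hχ.le, Real.rpow_one, ← mul_assoc]
    have h1 : 1 ≤ ε * x := by rwa [div_le_iff₀' hε] at h
    have : 0 ≤ (1 / ε) ^ χ := by positivity
    have : 0 ≤ x ^ χ := by positivity
    nlinarith

lemma div_eight_le_card_filter {n : ℕ} (hn : 4 ≤ n) :
    (n : ℝ) / 8 ≤ ∑ i : Fin n, if 4 * (i.1 + 1) ≤ n then (1 : ℝ) else 0 := by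
  have h : (Finset.univ.filter fun i : Fin n => 4 * (i.1 + 1) ≤ n).card = n / 4 := by
    have : (Finset.univ.filter fun i : Fin n => 4 * (i.1 + 1) ≤ n)
        = Finset.univ.filter fun i : Fin n => i.1 < n / 4 := by
      ext i
      simp only [Finset.mem_filter, Finset.mem_univ, true_and]
      omega
    rw [this, Fin.card_filter_val_lt]
    omega
  rw [← Finset.sum_filter, Finset.sum_const, h, nsmul_eq_mul, mul_one]
  have : n ≤ 8 * (n / 4) := by omega
  have : (n : ℝ) ≤ 8 * (n / 4 : ℕ) := by exact_mod_cast this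
  linarith

/-- Quantitative Chebyshev inequality when the centred increasing sequence `g` is still
nonpositive at rank `i₀`. -/
lemma sum_mul_le_of_nonpos_at {n : ℕ} (hn : 4 ≤ n) {η g : Fin n → ℝ} (hη : Antitone η)
    (hg : Monotone g) (hsum : ∑ i, g i = 0) {i₀ : Fin n} (h0 : g i₀ ≤ 0) {δ : ℝ} (hδ0 : 0 ≤ δ)
    (hδ : ∀ i : Fin n, 4 * (i.1 + 1) ≤ n → η i₀ + δ ≤ η i) :
    ∑ i, η i * g i ≤ -(δ / 16) * ∑ i, |g i| := by
  have hne : (Finset.univ.filter fun i => g i ≤ 0).Nonempty := ⟨i₀, by simpa using h0⟩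
  set k := (Finset.univ.filter fun i => g i ≤ 0).max' hne
  have hk : ∀ i, g i ≤ 0 → i ≤ k := fun i hi => Finset.le_max' _ _ (by simpa using hi)
  have hk0 : g k ≤ 0 := by simpa using Finset.max'_mem _ hne
  set q : Fin n → ℝ := fun i => if 4 * (i.1 + 1) ≤ n then 1 else 0
  have hpt : ∀ i, η i * g i ≤ η k * g i - δ * (q i * max (-g i) 0) := by
    intro i
    rcases le_total (g i) 0 with hi | hi
    · rw [max_eq_left (by linarith)]
      have h1 := hη (hk i hi)
      by_cases hq : 4 * (i.1 + 1) ≤ n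
      · have h2 := hδ i hq
        have h3 := hη (hk i₀ h0)
        simp only [q, if_pos hq]
        nlinarith
      · simp only [q, if_neg hq]
        nlinarith
    · rw [max_eq_right (by linarith)]
      rcases le_total i k with hik | hik
      · have : g i = 0 := le_antisymm ((hg hik).trans hk0) hi
        simp [this]
      · have := hη hik
        nlinarith
  have hcheb := Monovary.sum_mul_sum_le_card_mul_sum (f := q) (g := fun i => max (-g i) 0) (by
    refine Antitone.monovary (fun i j hij => ?_) fun i j hij =>
      max_le_max (neg_le_neg (hg hij)) le_rfl
    have : i.1 ≤ j.1 := hij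
    simp only [q]
    split_ifs <;> first | omega | norm_num)
  have habs : ∑ i, |g i| = 2 * ∑ i, max (-g i) 0 := by
    have : ∀ i, |g i| = g i + 2 * max (-g i) 0 := fun i => by
      rcases le_total (g i) 0 with hi | hi
      · rw [abs_of_nonpos hi, max_eq_left (by linarith)]; ring
      · rw [abs_of_nonneg hi, max_eq_right (by linarith)]; ring
    simp_rw [this]
    rw [Finset.sum_add_distrib, hsum, zero_add, Finset.mul_sum]
  have hS := Finset.sum_le_sum fun i (_ : i ∈ Finset.univ) => hpt i
  rw [Finset.sum_sub_distrib, ← Finset.mul_sum, hsum, ← Finset.mul_sum] at hS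
  rw [Fintype.card_fin] at hcheb
  have hcard := div_eight_le_card_filter hn
  have hneg : 0 ≤ ∑ i, max (-g i) 0 := Finset.sum_nonneg fun i _ => le_max_right _ _
  have hn0 : (0 : ℝ) < n := by exact_mod_cast (by omega : 0 < n)
  have h1 : (n : ℝ) * ((∑ i, max (-g i) 0) / 8) ≤ n * ∑ i, q i * max (-g i) 0 := by
    refine le_trans ?_ hcheb
    calc (n : ℝ) * ((∑ i, max (-g i) 0) / 8) = n / 8 * ∑ i, max (-g i) 0 := by ring
      _ ≤ _ := mul_le_mul_of_nonneg_right hcard hneg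
  have h2 := mul_le_mul_of_nonneg_left (le_of_mul_le_mul_left h1 hn0) hδ0
  rw [habs]
  linarith

/-- Quantitative Chebyshev inequality: `η` drops by `δ` both from the first quarter to the rank
`i₀` and from `i₀` to the last quarter. -/
lemma sum_mul_le_neg_sum_abs {n : ℕ} (hn : 4 ≤ n) {η g : Fin n → ℝ} (hη : Antitone η)
    (hg : Monotone g) (hsum : ∑ i, g i = 0) (i₀ : Fin n) {δ : ℝ} (hδ0 : 0 ≤ δ)
    (hδ : ∀ i : Fin n, 4 * (i.1 + 1) ≤ n → η i₀ + δ ≤ η i)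
    (hδ' : ∀ i : Fin n, 3 * n ≤ 4 * (i.1 + 1) → η i + δ ≤ η i₀) :
    ∑ i, η i * g i ≤ -(δ / 16) * ∑ i, |g i| := by
  rcases le_total (g i₀) 0 with h0 | h0
  · exact sum_mul_le_of_nonpos_at hn hη hg hsum h0 hδ0 hδ
  · have hrev : ∀ F : Fin n → ℝ, ∑ i : Fin n, F i.rev = ∑ i, F i := fun F =>
      Equiv.sum_comp Fin.revPerm F
    have h := sum_mul_le_of_nonpos_at hn (η := fun i => -η i.rev) (g := fun i => -g i.rev)
      (fun i j hij => neg_le_neg (hη (Fin.rev_le_rev.2 hij)))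
      (fun i j hij => neg_le_neg (hg (Fin.rev_le_rev.2 hij)))
      (by rw [Finset.sum_neg_distrib, hrev g, hsum, neg_zero])
      (i₀ := i₀.rev) (by simpa using h0) hδ0 (fun i hi => by
        have := hδ' (Fin.rev i) (by rw [Fin.val_rev]; omega)
        simp only [Fin.rev_rev]
        linarith)
    simp only [neg_mul_neg, abs_neg] at h
    rwa [hrev fun j : Fin n => η j * g j, hrev fun j => |g j|] at h

/-- A one-step Foster–Lyapunov bound: if `∫ V dκ(w) + f w ≤ V w + C` almost surely for an
invariant probability measure, then `∫ f ≤ C`, with no integrability assumption on `V`. -/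
lemma lintegral_le_of_drift {α : Type*} [MeasurableSpace α] {π : Measure α}
    [IsProbabilityMeasure π] {κ : α → Measure α} (hinv : π.bind κ = π)
    (hκ : ∀ a, κ a univ ≤ 1) {V : α → ℝ≥0∞} {f : α → ℝ≥0∞} (hV : Measurable V)
    (hVtop : ∀ a, V a ≠ ∞) (hf : Measurable f) {C : ℝ≥0∞}
    (hdrift : ∀ᵐ a ∂π, ∫⁻ b, V b ∂κ a + f a ≤ V a + C) :
    ∫⁻ a, f a ∂π ≤ C := by
  have htrunc : ∀ M : ℕ, ∫⁻ a, {a | V a ≤ M}.indicator f a ∂π ≤ C := by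
    intro M
    have hmeas : Measurable ({a | V a ≤ M}.indicator f) :=
      hf.indicator (hV measurableSet_Iic)
    have hpt : ∀ᵐ a ∂π, ∫⁻ b, min (V b) M ∂κ a + {a | V a ≤ M}.indicator f a
        ≤ min (V a) M + C := by
      filter_upwards [hdrift] with a ha
      by_cases hM : V a ≤ M
      · rw [indicator_of_mem (by exact hM), min_eq_left hM]
        exact (add_le_add (lintegral_mono fun b => min_le_left _ _) le_rfl).trans ha
      · rw [indicator_of_notMem (by exact hM), add_zero, min_eq_right (not_le.1 hM).le]
        calc ∫⁻ b, min (V b) M ∂κ a ≤ ∫⁻ _, M ∂κ a := lintegral_mono fun b => min_le_right _ _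
          _ = M * κ a univ := lintegral_const _
          _ ≤ M * 1 := mul_le_mul_right (hκ a) _
          _ ≤ M + C := by rw [mul_one]; exact le_self_add
    have hle : ∫⁻ a, min (V a) M ∂π ≤ ∫⁻ a, ∫⁻ b, min (V b) M ∂κ a ∂π := by
      conv_lhs => rw [← hinv]
      exact Measure.lintegral_bind_le _ _ _
    have hfin : ∫⁻ a, min (V a) M ∂π ≠ ∞ := by
      refine ne_top_of_le_ne_top (ENNReal.natCast_ne_top M) ?_
      calc ∫⁻ a, min (V a) M ∂π ≤ ∫⁻ _, M ∂π := lintegral_mono fun b => min_le_right _ _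
        _ = M := by simp
    have h := lintegral_mono_ae hpt
    rw [lintegral_add_right _ hmeas, lintegral_add_right _ measurable_const, lintegral_const,
      measure_univ, mul_one] at h
    exact (ENNReal.add_le_add_iff_left hfin).1 ((add_le_add hle le_rfl).trans h)
  have hsup : ∀ a, ⨆ M : ℕ, {a | V a ≤ M}.indicator f a = f a := by
    intro a
    refine le_antisymm (iSup_le fun M => indicator_le_self _ _ _) ?_
    obtain ⟨M, hM⟩ := ENNReal.exists_nat_gt (hVtop a)
    refine le_trans ?_ (le_iSup _ M)
    rw [indicator_of_mem (by exact hM.le)]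
  calc ∫⁻ a, f a ∂π = ∫⁻ a, ⨆ M : ℕ, {a | V a ≤ M}.indicator f a ∂π := by simp_rw [hsup]
    _ = ⨆ M : ℕ, ∫⁻ a, {a | V a ≤ M}.indicator f a ∂π := by
        refine lintegral_iSup (fun M => hf.indicator (hV measurableSet_Iic)) ?_
        intro M N hMN a
        refine indicator_le_indicator_of_subset (fun b hb => ?_) (fun _ => zero_le) a
        exact le_trans (show V b ≤ M from hb) (by exact_mod_cast hMN)
    _ ≤ C := iSup_le htrunc

/-- Effect of one jump of the rank-`ℓ` particle on the `(2 + χ)`-th moment. -/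
lemma sum_abs_jump_rpow_le {n : ℕ} (hn : 1 ≤ n) {χ : ℝ} (hχ : 0 < χ) (w : Fin n → ℝ) (ℓ : Fin n)
    (z : ℝ) :
    ∑ i, |w i + (if i = ℓ then z else 0) - z / n| ^ (2 + χ) ≤
      ∑ i, |w i| ^ (2 + χ)
      + (2 + χ) * (|w ℓ| ^ χ * w ℓ - 1 / n * ∑ i, |w i| ^ χ * w i) * z
      + (2 + χ) * (1 + χ) * 2 ^ χ * (|w ℓ| ^ χ + Phi n χ w) * z ^ 2
      + (2 + χ) * (1 + χ) * 2 ^ χ * 2 * |z| ^ (2 + χ) := by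
  have hn0 : (0 : ℝ) < n := by exact_mod_cast hn
  have hn1 : (1 : ℝ) ≤ n := by exact_mod_cast hn
  set b : Fin n → ℝ := fun i => (if i = ℓ then 1 else 0) - 1 / n
  have hinv : (1 : ℝ) / n ≤ 1 := by rw [div_le_one hn0]; exact hn1
  have hinv0 : (0 : ℝ) < 1 / n := by positivity
  have hb1 : ∀ i, |b i| ≤ 1 := fun i => by
    simp only [b]
    rw [abs_le]
    split_ifs <;> constructor <;> linarith
  have hb2 : ∀ i, b i ^ 2 ≤ (if i = ℓ then 1 else 0) + 1 / n := fun i => by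
    simp only [b]
    split_ifs <;> nlinarith
  have hbp : ∀ i, |b i| ^ (2 + χ) ≤ (if i = ℓ then 1 else 0) + 1 / n := fun i => by
    refine le_trans ?_ (hb2 i)
    rw [← sq_abs, ← Real.rpow_two]
    exact Real.rpow_le_rpow_of_exponent_ge_of_imp (abs_nonneg _) (hb1 i) (by linarith)
      fun _ h => by linarith
  set C := (2 + χ) * (1 + χ) * 2 ^ χ
  have hC : 0 ≤ C := by positivity
  have hpt : ∀ i, |w i + (if i = ℓ then z else 0) - z / n| ^ (2 + χ) ≤
      |w i| ^ (2 + χ) + (2 + χ) * z * ((|w i| ^ χ * w i) * b i)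
      + C * z ^ 2 * (|w i| ^ χ * ((if i = ℓ then 1 else 0) + 1 / n))
      + C * |z| ^ (2 + χ) * ((if i = ℓ then 1 else 0) + 1 / n) := by
    intro i
    have h1 := abs_add_rpow_taylor hχ (w i) (b i * z)
    have h2 : w i + (if i = ℓ then z else 0) - z / n = w i + b i * z := by
      simp only [b]
      split_ifs <;> ring
    rw [h2]
    refine h1.trans ?_
    rw [abs_mul, Real.mul_rpow (abs_nonneg _) (abs_nonneg _)]
    have h3 : C * z ^ 2 * (|w i| ^ χ * b i ^ 2) ≤
        C * z ^ 2 * (|w i| ^ χ * ((if i = ℓ then 1 else 0) + 1 / n)) :=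
      mul_le_mul_of_nonneg_left (mul_le_mul_of_nonneg_left (hb2 i) (by positivity)) (by positivity)
    have h4 := mul_le_mul_of_nonneg_left (hbp i) (by positivity : 0 ≤ C * |z| ^ (2 + χ))
    simp only [C] at h3 h4 ⊢
    linarith
  have hind : ∀ F : Fin n → ℝ, ∑ i, F i * (if i = ℓ then (1 : ℝ) else 0) = F ℓ := fun F => by
    simp
  refine (Finset.sum_le_sum fun i _ => hpt i).trans (le_of_eq ?_)
  rw [Finset.sum_add_distrib, Finset.sum_add_distrib, Finset.sum_add_distrib, ← Finset.mul_sum,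
    ← Finset.mul_sum, ← Finset.mul_sum]
  have e1 : ∑ i, (|w i| ^ χ * w i) * b i
      = |w ℓ| ^ χ * w ℓ - 1 / n * ∑ i, |w i| ^ χ * w i := by
    simp only [b, mul_sub]
    rw [Finset.sum_sub_distrib, hind, ← Finset.sum_mul, mul_comm (1 / (n : ℝ))]
  have e2 : ∑ i, |w i| ^ χ * ((if i = ℓ then 1 else 0) + 1 / n) = |w ℓ| ^ χ + Phi n χ w := by
    simp only [mul_add]
    rw [Finset.sum_add_distrib, hind, ← Finset.sum_mul, Phi, mul_comm (1 / (n : ℝ))]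
  have e3 : ∑ i : Fin n, ((if i = ℓ then (1 : ℝ) else 0) + 1 / n) = 2 := by
    rw [Finset.sum_add_distrib]
    simp [hn0.ne']
    norm_num
  rw [e1, e2, e3]
  ring

lemma sum_comp_sortVec {n : ℕ} (w : Fin n → ℝ) (F : ℝ → ℝ) :
    ∑ i, F (sortVec w i) = ∑ i, F (w i) :=
  Equiv.sum_comp (Tuple.sort w) fun i => F (w i)

lemma setLIntegral_threshold {e : ℝ} (he : e ∈ Icc (0 : ℝ) 1) (A B : ℝ≥0∞) :
    ∫⁻ u in Icc (0 : ℝ) 1, (if u ≤ e then A else B)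
      = ENNReal.ofReal e * A + ENNReal.ofReal (1 - e) * B := by
  have h : (fun u : ℝ => if u ≤ e then A else B)
      = fun u => (Iic e).indicator (fun _ => A) u + (Ioi e).indicator (fun _ => B) u := by
    ext u
    by_cases hu : u ≤ e
    · simp [hu]
    · simp [hu, not_le.1 hu]
  have h1 : Iic e ∩ Icc (0 : ℝ) 1 = Icc 0 e := by
    ext u
    simp only [mem_inter_iff, mem_Iic, mem_Icc]
    exact ⟨fun h => ⟨h.2.1, h.1⟩, fun h => ⟨h.2, h.1, h.2.trans he.2⟩⟩
  have h2 : Ioi e ∩ Icc (0 : ℝ) 1 = Ioc e 1 := by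
    ext u
    simp only [mem_inter_iff, mem_Ioi, mem_Icc, mem_Ioc]
    exact ⟨fun h => ⟨h.1, h.2.2⟩, fun h => ⟨h.1, he.1.trans h.1.le, h.2⟩⟩
  rw [h, lintegral_add_left (measurable_const.indicator measurableSet_Iic),
    lintegral_indicator_const measurableSet_Iic, lintegral_indicator_const measurableSet_Ioi,
    Measure.restrict_apply measurableSet_Iic, Measure.restrict_apply measurableSet_Ioi, h1, h2,
    Real.volume_Icc, Real.volume_Ioc, sub_zero, mul_comm A, mul_comm B]

lemma integrable_sq_of_integrable_rpow {J : Measure ℝ} [IsProbabilityMeasure J] {χ : ℝ}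
    (hχ : 0 < χ) (hJ : Integrable (fun z => |z| ^ (2 + χ)) J) :
    Integrable (fun z : ℝ => z ^ 2) J := by
  refine ((integrable_const (1 : ℝ)).add hJ).mono' (by fun_prop) (Eventually.of_forall fun z => ?_)
  rw [Real.norm_of_nonneg (sq_nonneg z), ← sq_abs, ← Real.rpow_two, Pi.add_apply]
  rcases le_total |z| 1 with h | h
  · have := Real.rpow_le_one (abs_nonneg z) h (by norm_num : (0 : ℝ) ≤ 2)
    have := Real.rpow_nonneg (abs_nonneg z) (2 + χ)
    linarith
  · have := Real.rpow_le_rpow_of_exponent_le h (by linarith : (2 : ℝ) ≤ 2 + χ)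
    linarith

/-- Bound on the conditional drift of the `(2 + χ)`-th moment when rank `ℓ` jumps. -/
noncomputable def jumpDrift (n : ℕ) (χ : ℝ) (J : Measure ℝ) (w : Fin n → ℝ) (ℓ : Fin n) : ℝ :=
  (2 + χ) * (|w ℓ| ^ χ * w ℓ - 1 / n * ∑ i, |w i| ^ χ * w i)
    + (2 + χ) * (1 + χ) * 2 ^ χ * (|w ℓ| ^ χ + Phi n χ w) * ∫ z, z ^ 2 ∂J
    + (2 + χ) * (1 + χ) * 2 ^ χ * 2 * ∫ z, |z| ^ (2 + χ) ∂J

section Moments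

variable {χ : ℝ} {J : Measure ℝ} [IsProbabilityMeasure J]

lemma lintegral_jump_le (hχ : 0 < χ) (hJmean : ∫ z, z ∂J = 1)
    (hJmom : Integrable (fun z => |z| ^ (2 + χ)) J) {n : ℕ} (hn : 1 ≤ n) (w : Fin n → ℝ)
    (ℓ : Fin n) :
    0 ≤ ∑ i, |w i| ^ (2 + χ) + jumpDrift n χ J w ℓ ∧
    ∫⁻ z, ENNReal.ofReal (∑ i, |w i + (if i = ℓ then z else 0) - z / n| ^ (2 + χ)) ∂J
      ≤ ENNReal.ofReal (∑ i, |w i| ^ (2 + χ) + jumpDrift n χ J w ℓ) := by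
  set S := ∑ i, |w i| ^ (2 + χ)
  set a := (2 + χ) * (|w ℓ| ^ χ * w ℓ - 1 / n * ∑ i, |w i| ^ χ * w i) with ha
  set b := (2 + χ) * (1 + χ) * 2 ^ χ * (|w ℓ| ^ χ + Phi n χ w) with hb
  set c := (2 + χ) * (1 + χ) * 2 ^ χ * 2 with hc
  have hle : ∀ z, ∑ i, |w i + (if i = ℓ then z else 0) - z / n| ^ (2 + χ)
      ≤ S + a * z + b * z ^ 2 + c * |z| ^ (2 + χ) :=
    sum_abs_jump_rpow_le hn hχ w ℓ
  have hnn : ∀ z, 0 ≤ S + a * z + b * z ^ 2 + c * |z| ^ (2 + χ) := fun z =>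
    le_trans (Finset.sum_nonneg fun i _ => by positivity) (hle z)
  have hi1 : Integrable (fun z : ℝ => a * z) J :=
    (integrable_of_integral_eq_one hJmean).const_mul a
  have hi2 := (integrable_sq_of_integrable_rpow hχ hJmom).const_mul b
  have hi3 := hJmom.const_mul c
  have hi0 : Integrable (fun _ : ℝ => S) J := integrable_const S
  have hi01 : Integrable (fun z : ℝ => S + a * z) J := hi0.add hi1
  have hi012 : Integrable (fun z : ℝ => S + a * z + b * z ^ 2) J := hi01.add hi2
  have hI : ∫ z, (S + a * z + b * z ^ 2 + c * |z| ^ (2 + χ)) ∂J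
      = S + jumpDrift n χ J w ℓ := by
    rw [integral_add hi012 hi3, integral_add hi01 hi2,
      integral_add hi0 hi1, integral_const_mul, integral_const_mul, integral_const_mul, hJmean,
      jumpDrift, ← ha, ← hb, ← hc]
    simp
    ring
  rw [← hI]
  have hi : Integrable (fun z : ℝ => S + a * z + b * z ^ 2 + c * |z| ^ (2 + χ)) J := hi012.add hi3
  refine ⟨integral_nonneg hnn, ?_⟩
  rw [ofReal_integral_eq_lintegral_ofReal hi (Eventually.of_forall hnn)]
  exact lintegral_mono fun z => ENNReal.ofReal_le_ofReal (hle z)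

lemma Kn_univ_le_one {n : ℕ} (hn : 1 ≤ n) (ηn w : Fin n → ℝ) : Kn n ηn J w univ ≤ 1 := by
  have h := lintegral_map_le (μ := (((n : ℝ≥0∞))⁻¹ • (Measure.count : Measure (Fin n))).prod
      ((volume.restrict (Icc (0 : ℝ) 1)).prod J)) (fun _ => (1 : ℝ≥0∞)) (jumpOutcome n ηn w)
  rw [lintegral_one, lintegral_one] at h
  refine h.trans (le_of_eq ?_)
  rw [← univ_prod_univ, Measure.prod_prod, ← univ_prod_univ, Measure.prod_prod]
  simp [Measure.count_apply, ENNReal.inv_mul_cancel (by simp; omega : (n : ℝ≥0∞) ≠ 0)]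

lemma lintegral_Kn_le (hχ : 0 < χ) (hJmean : ∫ z, z ∂J = 1)
    (hJmom : Integrable (fun z => |z| ^ (2 + χ)) J) {n : ℕ} (hn : 1 ≤ n) {ηn : Fin n → ℝ}
    (hη : ∀ ℓ, ηn ℓ ∈ Icc (0 : ℝ) 1) (w : Fin n → ℝ) :
    0 ≤ ∑ i, |w i| ^ (2 + χ) + 1 / n * ∑ ℓ, ηn ℓ * jumpDrift n χ J w ℓ ∧
    ∫⁻ w', ENNReal.ofReal (∑ i, |w' i| ^ (2 + χ)) ∂(Kn n ηn J w)
      ≤ ENNReal.ofReal (∑ i, |w i| ^ (2 + χ) + 1 / n * ∑ ℓ, ηn ℓ * jumpDrift n χ J w ℓ) := by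
  have hn0 : (0 : ℝ) < n := by exact_mod_cast hn
  set S := ∑ i, |w i| ^ (2 + χ) with hS
  have hS0 : 0 ≤ S := Finset.sum_nonneg fun i _ => by positivity
  set D := jumpDrift n χ J w
  have hinner : ∀ ℓ : Fin n, ∫⁻ u in Icc (0 : ℝ) 1, ∫⁻ z,
      ENNReal.ofReal (∑ i, |jumpOutcome n ηn w (ℓ, u, z) i| ^ (2 + χ)) ∂J
      ≤ ENNReal.ofReal (S + ηn ℓ * D ℓ) := by
    intro ℓ
    obtain ⟨hpos, hle⟩ := lintegral_jump_le hχ hJmean hJmom hn w ℓ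
    have hu : ∀ u : ℝ, ∫⁻ z,
        ENNReal.ofReal (∑ i, |jumpOutcome n ηn w (ℓ, u, z) i| ^ (2 + χ)) ∂J
        ≤ if u ≤ ηn ℓ then ENNReal.ofReal (S + D ℓ) else ENNReal.ofReal S := by
      intro u
      by_cases h : u ≤ ηn ℓ
      · simp only [jumpOutcome, h, if_true]
        refine le_trans (le_of_eq ?_) hle
        refine lintegral_congr fun z => ?_
        rw [sum_comp_sortVec _ fun x => |x| ^ (2 + χ)]
      · simp [jumpOutcome, h, hS]
    refine (lintegral_mono hu).trans ?_
    rw [setLIntegral_threshold (hη ℓ), ← ENNReal.ofReal_mul (hη ℓ).1,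
      ← ENNReal.ofReal_mul (sub_nonneg.2 (hη ℓ).2), ← ENNReal.ofReal_add
      (mul_nonneg (hη ℓ).1 hpos) (mul_nonneg (sub_nonneg.2 (hη ℓ).2) hS0)]
    exact ENNReal.ofReal_le_ofReal (by linarith)
  have hterm : ∀ ℓ, 0 ≤ S + ηn ℓ * D ℓ := by
    intro ℓ
    have h1 := (lintegral_jump_le hχ hJmean hJmom hn w ℓ).1
    have h2 := mul_nonneg (hη ℓ).1 h1
    have h3 := mul_nonneg (sub_nonneg.2 (hη ℓ).2) hS0
    simp only [D]
    linarith
  have hsum : (1 : ℝ) / n * ∑ ℓ, (S + ηn ℓ * D ℓ) = S + 1 / n * ∑ ℓ, ηn ℓ * D ℓ := by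
    rw [Finset.sum_add_distrib]
    simp only [Finset.sum_const, Finset.card_univ, Fintype.card_fin, nsmul_eq_mul]
    field_simp
  rw [← hsum]
  refine ⟨mul_nonneg (by positivity) (Finset.sum_nonneg fun ℓ _ => hterm ℓ), ?_⟩
  refine (lintegral_map_le _ _).trans ((lintegral_prod_le _).trans ?_)
  rw [lintegral_smul_measure, lintegral_count, tsum_fintype, smul_eq_mul]
  calc (n : ℝ≥0∞)⁻¹ * ∑ ℓ, ∫⁻ y, ENNReal.ofReal
        (∑ i, |jumpOutcome n ηn w (ℓ, y) i| ^ (2 + χ)) ∂((volume.restrict (Icc (0 : ℝ) 1)).prod J)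
      ≤ (n : ℝ≥0∞)⁻¹ * ∑ ℓ, ENNReal.ofReal (S + ηn ℓ * D ℓ) :=
        mul_le_mul_right (Finset.sum_le_sum fun ℓ _ =>
          (lintegral_prod_le _).trans (hinner ℓ)) _
    _ = ENNReal.ofReal (1 / n * ∑ ℓ, (S + ηn ℓ * D ℓ)) := by
        rw [ENNReal.ofReal_mul (by positivity), ENNReal.ofReal_sum_of_nonneg fun ℓ _ => hterm ℓ,
          one_div, ENNReal.ofReal_inv_of_pos hn0, ENNReal.ofReal_natCast]

end Moments

lemma monotone_abs_rpow_mul_self {χ : ℝ} (hχ : 0 < χ) :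
    Monotone fun t : ℝ => |t| ^ χ * t :=
  monotone_of_hasDerivAt_nonneg (hasDerivAt_abs_rpow_mul_self hχ) fun _ => by
    simp only [Pi.zero_apply]
    positivity

/-- Negative drift of the `(2 + χ)`-th moment, up to lower-order moments. -/
lemma drift_le {χ : ℝ} (hχ : 0 < χ) (J : Measure ℝ) {n : ℕ} (hn : 4 ≤ n) {η w : Fin n → ℝ}
    (hη : Antitone η) (hη01 : ∀ ℓ, η ℓ ∈ Icc (0 : ℝ) 1) (hw : w ∈ Wset n) (i₀ : Fin n) {δ : ℝ}
    (hδ0 : 0 ≤ δ) (hδ : ∀ i : Fin n, 4 * (i.1 + 1) ≤ n → η i₀ + δ ≤ η i)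
    (hδ' : ∀ i : Fin n, 3 * n ≤ 4 * (i.1 + 1) → η i + δ ≤ η i₀) :
    1 / n * ∑ ℓ, η ℓ * jumpDrift n χ J w ℓ ≤
      -((2 + χ) * (δ / 48)) * Phi n (1 + χ) w
        + (2 + χ) * (1 + χ) * 2 ^ χ * 2 * (∫ z, z ^ 2 ∂J) * Phi n χ w
        + (2 + χ) * (1 + χ) * 2 ^ χ * 2 * ∫ z, |z| ^ (2 + χ) ∂J := by
  have hn0 : (0 : ℝ) < n := by exact_mod_cast (by omega : 0 < n)
  set M₂ := ∫ z, z ^ 2 ∂J with hM₂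
  set Mp := ∫ z, |z| ^ (2 + χ) ∂J with hMp
  have hM₂0 : 0 ≤ M₂ := integral_nonneg fun z => sq_nonneg z
  have hMp0 : 0 ≤ Mp := integral_nonneg fun z => by positivity
  set K := (2 + χ) * (1 + χ) * 2 ^ χ with hK
  have hK0 : 0 ≤ K := by positivity
  set H := 1 / n * ∑ i, |w i| ^ χ * w i with hH
  set g : Fin n → ℝ := fun i => |w i| ^ χ * w i - H
  have hΦ0 : 0 ≤ Phi n χ w :=
    mul_nonneg (by positivity) (Finset.sum_nonneg fun i _ => by positivity)
  have hgsum : ∑ i, g i = 0 := by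
    simp only [g, Finset.sum_sub_distrib, Finset.sum_const, Finset.card_univ, Fintype.card_fin,
      nsmul_eq_mul, hH]
    field_simp
    ring
  have hgmono : Monotone g := fun i j hij =>
    sub_le_sub_right (monotone_abs_rpow_mul_self hχ (hw.1 hij)) H
  have hcov := sum_mul_le_neg_sum_abs hn hη hgmono hgsum i₀ hδ0 hδ hδ'
  have hosc := sum_abs_le_sum_abs_sub hχ H w hw.2
  have habs : ∑ i, |(|w i| ^ χ * w i)| = n * Phi n (1 + χ) w := by
    rw [Phi, ← mul_assoc, mul_one_div_cancel hn0.ne', one_mul]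
    refine Finset.sum_congr rfl fun i _ => ?_
    rw [abs_mul, abs_of_nonneg (by positivity : 0 ≤ |w i| ^ χ), add_comm 1 χ,
      Real.rpow_add_of_nonneg (abs_nonneg _) hχ.le zero_le_one, Real.rpow_one]
  rw [habs] at hosc
  have hpt : ∀ ℓ, η ℓ * jumpDrift n χ J w ℓ ≤
      (2 + χ) * (η ℓ * g ℓ) + K * M₂ * |w ℓ| ^ χ + (K * M₂ * Phi n χ w + K * 2 * Mp) := by
    intro ℓ
    have hr : 0 ≤ K * M₂ * |w ℓ| ^ χ + (K * M₂ * Phi n χ w + K * 2 * Mp) := by positivity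
    have h1 := mul_le_of_le_one_left hr (hη01 ℓ).2
    have h2 : jumpDrift n χ J w ℓ =
        (2 + χ) * g ℓ + (K * M₂ * |w ℓ| ^ χ + (K * M₂ * Phi n χ w + K * 2 * Mp)) := by
      simp only [jumpDrift, g, ← hH, ← hM₂, ← hMp, ← hK]
      ring
    rw [h2, mul_add]
    linarith
  have hs := Finset.sum_le_sum fun ℓ (_ : ℓ ∈ Finset.univ) => hpt ℓ
  have hΦ : ∑ i, |w i| ^ χ = n * Phi n χ w := by
    rw [Phi, ← mul_assoc, mul_one_div_cancel hn0.ne', one_mul]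
  rw [Finset.sum_add_distrib, Finset.sum_add_distrib, ← Finset.mul_sum, ← Finset.mul_sum, hΦ,
    Finset.sum_const, Finset.card_univ, Fintype.card_fin, nsmul_eq_mul] at hs
  have hcov' : ∑ i, η i * g i ≤ -(δ / 48) * (n * Phi n (1 + χ) w) := by
    have := mul_le_mul_of_nonneg_left hosc (by positivity : 0 ≤ δ / 48)
    linarith
  have hcov'' := mul_le_mul_of_nonneg_left hcov' (by positivity : 0 ≤ 2 + χ)
  rw [one_div, inv_mul_le_iff₀ hn0]
  linarith

lemma Phi_le_mul_Phi_add {χ ε : ℝ} (hχ : 0 < χ) (hε : 0 < ε) {n : ℕ} (hn : 1 ≤ n)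
    (w : Fin n → ℝ) : Phi n χ w ≤ ε * Phi n (1 + χ) w + (1 / ε) ^ χ := by
  have hn0 : (0 : ℝ) < n := by exact_mod_cast hn
  have h := Finset.sum_le_sum fun i (_ : i ∈ Finset.univ) =>
    rpow_le_mul_rpow_add hχ hε (abs_nonneg (w i))
  rw [Finset.sum_add_distrib, ← Finset.mul_sum, Finset.sum_const, Finset.card_univ,
    Fintype.card_fin, nsmul_eq_mul] at h
  rw [Phi, Phi, one_div (n : ℝ), inv_mul_le_iff₀ hn0]
  refine h.trans (le_of_eq ?_)
  field_simp

/-- A uniform gap of `η_n` between the first quarter, the middle, and the last quarter. -/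
lemma exists_gap {η : ℝ → ℝ} (hη : StrictAntiOn η (Icc 0 1)) {ηn : (n : ℕ) → Fin n → ℝ}
    (hconv : Tendsto (fun n => ⨆ ℓ : Fin n, |ηn n ℓ - η ((ℓ.1 + 1 : ℝ) / n)|) atTop (nhds 0)) :
    ∃ δ : ℝ, 0 < δ ∧ ∃ N : ℕ, 4 ≤ N ∧ ∀ n, N ≤ n → ∃ i₀ : Fin n,
      (∀ i : Fin n, 4 * (i.1 + 1) ≤ n → ηn n i₀ + δ ≤ ηn n i) ∧
      (∀ i : Fin n, 3 * n ≤ 4 * (i.1 + 1) → ηn n i + δ ≤ ηn n i₀) := by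
  have hm : ∀ x : ℝ, 0 ≤ x → x ≤ 1 → x ∈ Icc (0 : ℝ) 1 := fun x h h' => ⟨h, h'⟩
  have h1 : η (1 / 2) < η (1 / 4) := hη (hm _ (by norm_num) (by norm_num))
    (hm _ (by norm_num) (by norm_num)) (by norm_num)
  have h2 : η (3 / 4) < η (5 / 8) := hη (hm _ (by norm_num) (by norm_num))
    (hm _ (by norm_num) (by norm_num)) (by norm_num)
  obtain ⟨δ, hδ, hδ1, hδ2⟩ : ∃ δ : ℝ, 0 < δ ∧ η (1 / 2) + 3 * δ ≤ η (1 / 4) ∧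
      η (3 / 4) + 3 * δ ≤ η (5 / 8) := by
    refine ⟨min (η (1 / 4) - η (1 / 2)) (η (5 / 8) - η (3 / 4)) / 3,
      div_pos (lt_min (by linarith) (by linarith)) (by norm_num), ?_, ?_⟩
    · have := min_le_left (η (1 / 4) - η (1 / 2)) (η (5 / 8) - η (3 / 4))
      linarith
    · have := min_le_right (η (1 / 4) - η (1 / 2)) (η (5 / 8) - η (3 / 4))
      linarith
  obtain ⟨N, hN⟩ := eventually_atTop.1 (hconv.eventually (gt_mem_nhds hδ))
  refine ⟨δ, hδ, max N 8, le_trans (by norm_num) (le_max_right _ _), fun n hn => ?_⟩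
  have hnN := hN n ((le_max_left _ _).trans hn)
  have hn8 : 8 ≤ n := (le_max_right _ _).trans hn
  have hn0 : (0 : ℝ) < n := by exact_mod_cast (by omega : 0 < n)
  have hclose : ∀ i : Fin n, |ηn n i - η ((i.1 + 1 : ℝ) / n)| < δ := fun i =>
    (le_ciSup (f := fun ℓ : Fin n => |ηn n ℓ - η ((ℓ.1 + 1 : ℝ) / n)|)
      (finite_range _).bddAbove i).trans_lt hnN
  have hmem : ∀ i : Fin n, (i.1 + 1 : ℝ) / n ∈ Icc (0 : ℝ) 1 := fun i =>
    ⟨by positivity, (div_le_one hn0).2 (by exact_mod_cast i.2)⟩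
  have hge : ∀ (i : Fin n) (x : ℝ), x ∈ Icc (0 : ℝ) 1 → (i.1 + 1 : ℝ) ≤ x * n →
      η x - δ ≤ ηn n i := fun i x hx h => by
    have := hη.antitoneOn (hmem i) hx ((div_le_iff₀ hn0).2 h)
    linarith [(abs_lt.1 (hclose i)).1]
  have hle : ∀ (i : Fin n) (x : ℝ), x ∈ Icc (0 : ℝ) 1 → x * n ≤ (i.1 + 1 : ℝ) →
      ηn n i ≤ η x + δ := fun i x hx h => by
    have := hη.antitoneOn hx (hmem i) ((le_div_iff₀ hn0).2 h)
    linarith [(abs_lt.1 (hclose i)).2]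
  have hmid1 : (n : ℝ) ≤ 2 * ((n / 2 : ℕ) + 1) := by
    exact_mod_cast (by omega : n ≤ 2 * (n / 2 + 1))
  have hmid2 : 8 * ((n / 2 : ℕ) + 1 : ℝ) ≤ 5 * n := by
    exact_mod_cast (by omega : 8 * (n / 2 + 1) ≤ 5 * n)
  refine ⟨⟨n / 2, by omega⟩, fun i hi => ?_, fun i hi => ?_⟩
  · have hi' : 4 * (i.1 + 1 : ℝ) ≤ n := by exact_mod_cast hi
    have a1 := hge i (1 / 4) (hm _ (by norm_num) (by norm_num)) (by linarith)
    have a2 := hle ⟨n / 2, by omega⟩ (1 / 2) (hm _ (by norm_num) (by norm_num))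
      (by simp only; linarith)
    linarith
  · have hi' : 3 * (n : ℝ) ≤ 4 * (i.1 + 1) := by exact_mod_cast hi
    have a1 := hle i (3 / 4) (hm _ (by norm_num) (by norm_num)) (by linarith)
    have a2 := hge ⟨n / 2, by omega⟩ (5 / 8) (hm _ (by norm_num) (by norm_num))
      (by simp only; linarith)
    linarith

lemma measurableSet_Wset (n : ℕ) : MeasurableSet (Wset n) :=
  (isClosed_monotone.inter (isClosed_eq (by fun_prop) continuous_const)).measurableSet

lemma measurable_sum_abs_rpow (n : ℕ) (p : ℝ) :
    Measurable fun w : Fin n → ℝ => ∑ i, |w i| ^ p := by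
  fun_prop

section Theorems
open MeasureTheory Filter Set ENNReal NNReal

theorem uniform_stationary_moment_bound
    (χ : ℝ) (hχ : 0 < χ)
    (η : ℝ → ℝ)
    (hη_cont : ContinuousOn η (Set.Icc 0 1))
    (hη_anti : StrictAntiOn η (Set.Icc 0 1))
    (hη0 : η 0 = 1) (hη1 : η 1 = 0)
    (J : Measure ℝ) [IsProbabilityMeasure J]
    (hJ0 : J (Set.Iic 0) = 0)
    (hJmean : ∫ z, z ∂J = 1)
    (hJmom : Integrable (fun z => |z| ^ (2 + χ)) J)
    (hJdens : DensityLowerBdd J)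
    (ηn : (n : ℕ) → Fin n → ℝ)
    (hηn_mem : ∀ n, ∀ ℓ : Fin n, ηn n ℓ ∈ Set.Icc (0:ℝ) 1)
    (hηn_anti : ∀ n, ∀ i j : Fin n, i ≤ j → ηn n j ≤ ηn n i)
    (hηn_conv : Filter.Tendsto
      (fun n => ⨆ ℓ : Fin n, |ηn n ℓ - η ((ℓ.1 + 1 : ℝ) / n)|) Filter.atTop (nhds 0)) :
    ∃ C : ℝ, 0 < C ∧ ∃ N : ℕ, ∀ n, N ≤ n →
      ∀ π : Measure (Fin n → ℝ), IsProbabilityMeasure π →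
        π (Wset n) = 1 →
        π.bind (Kn n (ηn n) J) = π →
        ∫⁻ w, ENNReal.ofReal (Phi n (1 + χ) w) ∂π ≤ ENNReal.ofReal C := by
  obtain ⟨δ, hδ, N, hN4, hgap⟩ := exists_gap hη_anti hηn_conv
  set M₂ := ∫ z, z ^ 2 ∂J with hM₂
  set Mp := ∫ z, |z| ^ (2 + χ) ∂J with hMp
  have hM₂0 : 0 ≤ M₂ := integral_nonneg fun z => sq_nonneg z
  have hMp0 : 0 ≤ Mp := integral_nonneg fun z => by positivity
  set K := (2 + χ) * (1 + χ) * 2 ^ χ * 2 with hK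
  have hK0 : 0 ≤ K := by positivity
  set c := (2 + χ) * (δ / 96) with hc
  have hc0 : 0 < c := by positivity
  set ε := c / (K * M₂ + 1)
  have hε : 0 < ε := by positivity
  have hεc : K * M₂ * ε ≤ c := by
    have : ε * (K * M₂ + 1) = c := div_mul_cancel₀ c (by positivity)
    linarith
  set C := K * M₂ * (1 / ε) ^ χ + K * Mp with hC
  have hC0 : 0 ≤ C := by positivity
  refine ⟨c⁻¹ * C + 1, by positivity, N, fun n hn π hπ hπW hinv => ?_⟩
  have hn4 : 4 ≤ n := hN4.trans hn
  have hn1 : 1 ≤ n := by omega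
  obtain ⟨i₀, hi₀, hi₀'⟩ := hgap n hn
  have hΦ0 : ∀ w : Fin n → ℝ, 0 ≤ Phi n (1 + χ) w := fun w =>
    mul_nonneg (by positivity) (Finset.sum_nonneg fun i _ => by positivity)
  have hΦmeas : Measurable fun w : Fin n → ℝ => Phi n (1 + χ) w :=
    (measurable_sum_abs_rpow n (1 + χ)).const_mul _
  have hW : ∀ᵐ w ∂π, w ∈ Wset n :=
    (mem_ae_iff_prob_eq_one (measurableSet_Wset n)).2 hπW
  have hmain : ∫⁻ w, ENNReal.ofReal (c * Phi n (1 + χ) w) ∂π ≤ ENNReal.ofReal C := by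
    refine lintegral_le_of_drift hinv (fun w => Kn_univ_le_one hn1 (ηn n) w)
      (V := fun w => ENNReal.ofReal (∑ i, |w i| ^ (2 + χ)))
      (measurable_sum_abs_rpow n _).ennreal_ofReal (fun _ => ENNReal.ofReal_ne_top)
      (hΦmeas.const_mul c).ennreal_ofReal ?_
    filter_upwards [hW] with w hw
    obtain ⟨hpos, hle⟩ := lintegral_Kn_le hχ hJmean hJmom hn1 (hηn_mem n) w
    have hd := drift_le hχ J hn4 (fun i j => hηn_anti n i j) (hηn_mem n) hw i₀ hδ.le hi₀ hi₀'
    rw [← hM₂, ← hMp, ← hK] at hd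
    have hΦ := mul_le_mul_of_nonneg_left (Phi_le_mul_Phi_add hχ hε hn1 w)
      (by positivity : 0 ≤ K * M₂)
    have hεΦ := mul_le_mul_of_nonneg_right hεc (hΦ0 w)
    refine (add_le_add hle le_rfl).trans ?_
    rw [← ENNReal.ofReal_add hpos (mul_nonneg hc0.le (hΦ0 w)),
      ← ENNReal.ofReal_add (Finset.sum_nonneg fun i _ => by positivity) hC0]
    refine ENNReal.ofReal_le_ofReal ?_
    simp only [hC, hc] at hεΦ ⊢
    linarith
  calc ∫⁻ w, ENNReal.ofReal (Phi n (1 + χ) w) ∂π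
      = ∫⁻ w, ENNReal.ofReal c⁻¹ * ENNReal.ofReal (c * Phi n (1 + χ) w) ∂π := by
        refine lintegral_congr fun w => ?_
        rw [← ENNReal.ofReal_mul (by positivity), inv_mul_cancel_left₀ hc0.ne']
    _ = ENNReal.ofReal c⁻¹ * ∫⁻ w, ENNReal.ofReal (c * Phi n (1 + χ) w) ∂π :=
        lintegral_const_mul _ (hΦmeas.const_mul c).ennreal_ofReal
    _ ≤ ENNReal.ofReal c⁻¹ * ENNReal.ofReal C := mul_le_mul_right hmain _
    _ = ENNReal.ofReal (c⁻¹ * C) := (ENNReal.ofReal_mul (by positivity)).symm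
    _ ≤ ENNReal.ofReal (c⁻¹ * C + 1) := ENNReal.ofReal_le_ofReal (by linarith)

end Theorems
end
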